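/- Let α ∈ ℝ with αχ ≤ 0 and suppose ū ∈ U^E has constant combinatorial α-curvature (R_{α,i}(ū) independent of i). Then for every initial value u(0) ∈ ℝᴺ satisfying Σ_i e^{α u_i(0)} = Σ_i e^{α ū_i} (when α ≠ 0), respectively Σ_i u_i(0) = Σ_i ū_i (when α = 0), the solution of the extended normalized combinatorial α-Ricci flow du_i/dt = 2πχ/(Σ_{j=1}^N e^{α u_j}) − R̃_{α,i}(u) exists for all time t ∈ [0,∞) and converges exponentially fast to ū: there are constants C, β > 0 with ‖u(t) − ū‖ ≤ C e^{−βt} for all t ≥ 0. -/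

import Mathlib

open Real

/-- A combinatorial triangulation of a connected closed surface on the vertex set
`Fin N`: a nonempty set of triangular faces covering all vertices, such that every
edge (2-element subset of a face) lies in exactly two faces and the underlying
graph is connected. -/
structure TriSurface (N : ℕ) where
  /-- The set of faces, each a 3-element subset of the vertex set. -/
  F : Finset (Finset (Fin N))
  F_nonempty : F.Nonempty
  card_face : ∀ σ ∈ F, σ.card = 3
  vertex_cover : ∀ v : Fin N, ∃ σ ∈ F, v ∈ σ
  edge_two_faces : ∀ e : Finset (Fin N), e.card = 2 → (∃ σ ∈ F, e ⊆ σ) →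
    (F.filter fun σ => e ⊆ σ).card = 2
  connected : (SimpleGraph.fromRel fun i j => ∃ σ ∈ F, i ∈ σ ∧ j ∈ σ).Connected

namespace TriSurface

variable {N : ℕ}

/-- The edge set: all 2-element subsets of faces. -/
def edges (S : TriSurface N) : Finset (Finset (Fin N)) :=
  S.F.biUnion fun σ => Finset.powersetCard 2 σ

/-- The Euler characteristic `χ = N - |E| + |F|`. -/
def chi (S : TriSurface N) : ℤ :=
  (N : ℤ) - (S.edges.card : ℤ) + (S.F.card : ℤ)

/-- Weights on a triangulated surface: scheme coefficients `ε : V → {0,1}` and symmetric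
discrete conformal structure coefficients `η : E → ℝ`, subject to the structure conditions
`ε_s ε_t + η_st > 0` on every edge and `ε_q η_st + η_qs η_qt ≥ 0` in every face. -/
structure Weights (S : TriSurface N) where
  eps : Fin N → ℝ
  eta : Fin N → Fin N → ℝ
  eps01 : ∀ i, eps i = 0 ∨ eps i = 1
  eta_symm : ∀ i j, eta i j = eta j i
  structCond1 : ∀ i j : Fin N, ({i, j} : Finset (Fin N)) ∈ S.edges →
    eps i * eps j + eta i j > 0
  structCond2 : ∀ i j k : Fin N, ({i, j, k} : Finset (Fin N)) ∈ S.F →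
    i ≠ j → i ≠ k → j ≠ k → eps i * eta j k + eta i j * eta i k ≥ 0

variable {S : TriSurface N}

/-! ### Euclidean background -/

/-- Euclidean edge length `l_ij = sqrt(ε_i e^{2u_i} + ε_j e^{2u_j} + 2 η_ij e^{u_i+u_j})`. -/
noncomputable def lE (W : Weights S) (u : Fin N → ℝ) (i j : Fin N) : ℝ :=
  Real.sqrt (W.eps i * exp (2 * u i) + W.eps j * exp (2 * u j) +
    2 * W.eta i j * exp (u i + u j))

/-- The admissible space `U^E`: discrete conformal factors for which every face satisfies
the strict triangle inequalities. -/
def admissibleE (W : Weights S) (u : Fin N → ℝ) : Prop :=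
  ∀ i j k : Fin N, ({i, j, k} : Finset (Fin N)) ∈ S.F →
    lE W u i j + lE W u i k > lE W u j k

/-- The inner angle `θ_i^{jk}` at `i` in the face `{i,j,k}`, by the law of cosines. -/
noncomputable def thetaE (W : Weights S) (u : Fin N → ℝ) (i j k : Fin N) : ℝ :=
  arccos ((lE W u i j ^ 2 + lE W u i k ^ 2 - lE W u j k ^ 2) /
    (2 * lE W u i j * lE W u i k))

open Classical in
/-- The extended inner angle `θ̃_i^{jk}`: equal to `θ_i^{jk}` when the three strict triangle
inequalities hold in the face, to `π` when the edge opposite to `i` dominates, and to `0`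
otherwise. -/
noncomputable def thetaExE (W : Weights S) (u : Fin N → ℝ) (i j k : Fin N) : ℝ :=
  if lE W u i j + lE W u i k > lE W u j k ∧ lE W u i j + lE W u j k > lE W u i k ∧
      lE W u i k + lE W u j k > lE W u i j then thetaE W u i j k
  else if lE W u j k ≥ lE W u i j + lE W u i k then π else 0

open Classical in
/-- The angle at `i` in a face `σ` containing `i` (the half-sum over the two orderings of
the remaining two vertices; the angle is symmetric in the last two arguments). -/
noncomputable def faceAngleE (W : Weights S) (u : Fin N → ℝ) (i : Fin N)
    (σ : Finset (Fin N)) : ℝ :=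
  (1 / 2) * ∑ j ∈ σ.erase i, ∑ k ∈ (σ.erase i).erase j, thetaE W u i j k

open Classical in
/-- The extended angle at `i` in a face `σ` containing `i`. -/
noncomputable def faceAngleExE (W : Weights S) (u : Fin N → ℝ) (i : Fin N)
    (σ : Finset (Fin N)) : ℝ :=
  (1 / 2) * ∑ j ∈ σ.erase i, ∑ k ∈ (σ.erase i).erase j, thetaExE W u i j k

open Classical in
/-- The classical combinatorial curvature `K_i = 2π − Σ θ_i^{jk}`. -/
noncomputable def KE (W : Weights S) (u : Fin N → ℝ) (i : Fin N) : ℝ :=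
  2 * π - ∑ σ ∈ S.F.filter (fun σ => i ∈ σ), faceAngleE W u i σ

open Classical in
/-- The extended combinatorial curvature `K̃_i = 2π − Σ θ̃_i^{jk}`. -/
noncomputable def KExE (W : Weights S) (u : Fin N → ℝ) (i : Fin N) : ℝ :=
  2 * π - ∑ σ ∈ S.F.filter (fun σ => i ∈ σ), faceAngleExE W u i σ

/-- The combinatorial `α`-curvature `R_{α,i} = K_i e^{−α u_i}` (Euclidean background). -/
noncomputable def RE (W : Weights S) (α : ℝ) (u : Fin N → ℝ) (i : Fin N) : ℝ :=
  KE W u i * exp (-(α * u i))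

/-- The extended combinatorial `α`-curvature `R̃_{α,i} = K̃_i e^{−α u_i}` (Euclidean). -/
noncomputable def RExE (W : Weights S) (α : ℝ) (u : Fin N → ℝ) (i : Fin N) : ℝ :=
  KExE W u i * exp (-(α * u i))

/-- The Jacobian `∂K_i/∂u_j` of the curvature map in the Euclidean background. -/
noncomputable def DKE (W : Weights S) (u : Fin N → ℝ) (i j : Fin N) : ℝ :=
  fderiv ℝ (fun v => KE W v i) u (Pi.single j 1)

/-- The discrete `α`-Laplacian `(Δ_α g)_i = −e^{−α u_i} Σ_j (∂K_i/∂u_j) g_j` (Euclidean). -/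
noncomputable def LapE (W : Weights S) (α : ℝ) (u : Fin N → ℝ) (g : Fin N → ℝ)
    (i : Fin N) : ℝ :=
  -exp (-(α * u i)) * ∑ j, DKE W u i j * g j

/-! ### Hyperbolic background -/

/-- The inverse hyperbolic cosine. -/
noncomputable def arcosh (x : ℝ) : ℝ := Real.log (x + Real.sqrt (x ^ 2 - 1))

/-- Hyperbolic edge length
`l_ij = arcosh(sqrt((1+ε_i e^{2f_i})(1+ε_j e^{2f_j})) + η_ij e^{f_i+f_j})`. -/
noncomputable def lH (W : Weights S) (f : Fin N → ℝ) (i j : Fin N) : ℝ :=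
  arcosh (Real.sqrt ((1 + W.eps i * exp (2 * f i)) * (1 + W.eps j * exp (2 * f j))) +
    W.eta i j * exp (f i + f j))

open Classical in
/-- The coordinate change `f ↦ u` at a vertex with scheme coefficient `e`. -/
noncomputable def ucoord (e x : ℝ) : ℝ :=
  if e = 0 then x
  else (1 / 2) * Real.log ((Real.sqrt (1 + exp (2 * x)) - 1) / (Real.sqrt (1 + exp (2 * x)) + 1))

/-- The discrete conformal structure `u` associated to the conformal factor `f`
(hyperbolic background). -/
noncomputable def uOf (W : Weights S) (f : Fin N → ℝ) (i : Fin N) : ℝ :=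
  ucoord (W.eps i) (f i)

/-- The admissible space `U^H` (described in the `f`-coordinates): every face satisfies
the strict triangle inequalities. -/
def admissibleH (W : Weights S) (f : Fin N → ℝ) : Prop :=
  ∀ i j k : Fin N, ({i, j, k} : Finset (Fin N)) ∈ S.F →
    lH W f i j + lH W f i k > lH W f j k

/-- The inner angle `θ_i^{jk}` at `i` in the hyperbolic face `{i,j,k}`, by the hyperbolic
law of cosines. -/
noncomputable def thetaH (W : Weights S) (f : Fin N → ℝ) (i j k : Fin N) : ℝ :=
  arccos ((Real.cosh (lH W f i j) * Real.cosh (lH W f i k) - Real.cosh (lH W f j k)) /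
    (Real.sinh (lH W f i j) * Real.sinh (lH W f i k)))

open Classical in
/-- The extended hyperbolic inner angle `θ̃_i^{jk}`. -/
noncomputable def thetaExH (W : Weights S) (f : Fin N → ℝ) (i j k : Fin N) : ℝ :=
  if lH W f i j + lH W f i k > lH W f j k ∧ lH W f i j + lH W f j k > lH W f i k ∧
      lH W f i k + lH W f j k > lH W f i j then thetaH W f i j k
  else if lH W f j k ≥ lH W f i j + lH W f i k then π else 0

open Classical in
/-- The angle at `i` in a hyperbolic face `σ` containing `i`. -/
noncomputable def faceAngleH (W : Weights S) (f : Fin N → ℝ) (i : Fin N)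
    (σ : Finset (Fin N)) : ℝ :=
  (1 / 2) * ∑ j ∈ σ.erase i, ∑ k ∈ (σ.erase i).erase j, thetaH W f i j k

open Classical in
/-- The extended angle at `i` in a hyperbolic face `σ` containing `i`. -/
noncomputable def faceAngleExH (W : Weights S) (f : Fin N → ℝ) (i : Fin N)
    (σ : Finset (Fin N)) : ℝ :=
  (1 / 2) * ∑ j ∈ σ.erase i, ∑ k ∈ (σ.erase i).erase j, thetaExH W f i j k

open Classical in
/-- The classical combinatorial curvature (hyperbolic background). -/
noncomputable def KH (W : Weights S) (f : Fin N → ℝ) (i : Fin N) : ℝ :=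
  2 * π - ∑ σ ∈ S.F.filter (fun σ => i ∈ σ), faceAngleH W f i σ

open Classical in
/-- The extended combinatorial curvature (hyperbolic background). -/
noncomputable def KExH (W : Weights S) (f : Fin N → ℝ) (i : Fin N) : ℝ :=
  2 * π - ∑ σ ∈ S.F.filter (fun σ => i ∈ σ), faceAngleExH W f i σ

/-- The combinatorial `α`-curvature `R_{α,i} = K_i e^{−α u_i}` (hyperbolic background),
expressed as a function of the conformal factor `f`. -/
noncomputable def RH (W : Weights S) (α : ℝ) (f : Fin N → ℝ) (i : Fin N) : ℝ :=
  KH W f i * exp (-(α * uOf W f i))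

/-- The extended combinatorial `α`-curvature `R̃_{α,i} = K̃_i e^{−α u_i}` (hyperbolic). -/
noncomputable def RExH (W : Weights S) (α : ℝ) (f : Fin N → ℝ) (i : Fin N) : ℝ :=
  KExH W f i * exp (-(α * uOf W f i))

/-- The Jacobian `∂K_i/∂u_j` in the hyperbolic background, computed by the chain rule from
the `f`-coordinates: `(∂K_i/∂f_j) / (du_j/df_j)`. -/
noncomputable def DKH (W : Weights S) (f : Fin N → ℝ) (i j : Fin N) : ℝ :=
  fderiv ℝ (fun g => KH W g i) f (Pi.single j 1) / deriv (ucoord (W.eps j)) (f j)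

/-- The discrete `α`-Laplacian `(Δ_α g)_i = −e^{−α u_i} Σ_j (∂K_i/∂u_j) g_j` (hyperbolic). -/
noncomputable def LapH (W : Weights S) (α : ℝ) (f : Fin N → ℝ) (g : Fin N → ℝ)
    (i : Fin N) : ℝ :=
  -exp (-(α * uOf W f i)) * ∑ j, DKH W f i j * g j

/-- The Euclidean norm on `Fin N → ℝ`. -/
noncomputable def enorm (v : Fin N → ℝ) : ℝ := Real.sqrt (∑ i, v i ^ 2)

end TriSurface

open TriSurface

/-- A global solution of the extended normalized combinatorial `α`-Ricci flow
`du_i/dt = 2πχ/(Σ_j e^{α u_j}) − R̃_{α,i}(u)` (Euclidean background). -/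
def IsExtNormRicciSolE {N : ℕ} {S : TriSurface N} (W : TriSurface.Weights S) (α : ℝ)
    (u : ℝ → Fin N → ℝ) : Prop :=
  ∀ t ∈ Set.Ici (0 : ℝ), ∀ i, HasDerivWithinAt (fun s => u s i)
    (2 * Real.pi * (S.chi : ℝ) / (∑ j, Real.exp (α * u t j)) - RExE W α (u t) i)
    (Set.Ici (0 : ℝ)) t

/-- Exponential convergence of a flow to `ū`. -/
def ExpConvergesTo {N : ℕ} (u : ℝ → Fin N → ℝ) (ubar : Fin N → ℝ) : Prop :=
  ∃ C > (0 : ℝ), ∃ β > (0 : ℝ), ∀ t ≥ (0 : ℝ),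
    TriSurface.enorm (fun i => u t i - ubar i) ≤ C * Real.exp (-β * t)

section FlowAnalysis

open Real Filter Topology

/-- The angle at the first vertex of a Euclidean triangle, where the squared length of the side
joining the vertices `i` and `j` is `xᵢ + xⱼ + 2 yₖ`. -/
noncomputable def triAngle (x₁ x₂ x₃ y₁ y₂ y₃ : ℝ) : ℝ :=
  arccos ((x₁ + y₂ + y₃ - y₁) / (√(x₁ + x₃ + 2 * y₂) * √(x₁ + x₂ + 2 * y₃)))

/-- Four times the squared area of the triangle, extended to degenerate side lengths. -/
def triDisc (x₁ x₂ x₃ y₁ y₂ y₃ : ℝ) : ℝ :=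
  (x₁ + x₃ + 2 * y₂) * (x₁ + x₂ + 2 * y₃) - (x₁ + y₂ + y₃ - y₁) ^ 2

/-- The coefficient `√D l₁₂² ∂θ₁/∂u₂`. -/
def triCoeff (x₁ x₂ y₁ y₂ y₃ : ℝ) : ℝ :=
  (x₁ * x₂ - y₃ ^ 2) + (x₁ * y₁ + y₂ * y₃) + (x₂ * y₂ + y₁ * y₃)

/-- The cubic form whose positivity makes the Jacobian of the angles definite modulo scaling. -/
def triCubic (x₁ x₂ x₃ y₁ y₂ y₃ : ℝ) : ℝ :=
  2 * x₁ * (x₂ * x₃ - y₁ ^ 2) + (x₁ * y₁ + y₂ * y₃) * (x₂ + x₃ + 2 * y₁) +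
    (x₁ + x₂) * (x₃ * y₃ + y₁ * y₂) + (x₁ + x₃) * (x₂ * y₂ + y₁ * y₃)

/-- Positivity of the side lengths and of the cubic form of a triangle. -/
structure TriData (x₁ x₂ x₃ y₁ y₂ y₃ : ℝ) : Prop where
  len₁ : 0 < x₂ + x₃ + 2 * y₁
  len₂ : 0 < x₁ + x₃ + 2 * y₂
  len₃ : 0 < x₁ + x₂ + 2 * y₃
  cubic : 0 < triCubic x₁ x₂ x₃ y₁ y₂ y₃

section Triangle

variable {x₁ x₂ x₃ y₁ y₂ y₃ : ℝ}

lemma triDisc_rotate : triDisc x₂ x₃ x₁ y₂ y₃ y₁ = triDisc x₁ x₂ x₃ y₁ y₂ y₃ := by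
  unfold triDisc; ring

lemma triCubic_rotate : triCubic x₂ x₃ x₁ y₂ y₃ y₁ = triCubic x₁ x₂ x₃ y₁ y₂ y₃ := by
  unfold triCubic; ring

lemma TriData.rotate (h : TriData x₁ x₂ x₃ y₁ y₂ y₃) : TriData x₂ x₃ x₁ y₂ y₃ y₁ :=
  ⟨by linarith [h.len₂], by linarith [h.len₃], by linarith [h.len₁],
    h.cubic.trans_eq triCubic_rotate.symm⟩

lemma sq_triCos (h₂ : 0 < x₁ + x₃ + 2 * y₂) (h₃ : 0 < x₁ + x₂ + 2 * y₃) :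
    1 - ((x₁ + y₂ + y₃ - y₁) / (√(x₁ + x₃ + 2 * y₂) * √(x₁ + x₂ + 2 * y₃))) ^ 2 =
      triDisc x₁ x₂ x₃ y₁ y₂ y₃ / ((x₁ + x₃ + 2 * y₂) * (x₁ + x₂ + 2 * y₃)) := by
  rw [div_pow, mul_pow, sq_sqrt h₂.le, sq_sqrt h₃.le, triDisc, sub_div,
    div_self (mul_pos h₂ h₃).ne']

/-- A degenerate triangle has angles in `{0, π}`. -/
lemma triAngle_of_disc_nonpos (h : TriData x₁ x₂ x₃ y₁ y₂ y₃)
    (hD : triDisc x₁ x₂ x₃ y₁ y₂ y₃ ≤ 0) :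
    (x₁ + y₂ + y₃ - y₁ ≤ 0 ∧ triAngle x₁ x₂ x₃ y₁ y₂ y₃ = π) ∨
      (0 < x₁ + y₂ + y₃ - y₁ ∧ triAngle x₁ x₂ x₃ y₁ y₂ y₃ = 0) := by
  have h1 := sq_triCos (y₁ := y₁) h.len₂ h.len₃
  have h2 : triDisc x₁ x₂ x₃ y₁ y₂ y₃ / ((x₁ + x₃ + 2 * y₂) * (x₁ + x₂ + 2 * y₃)) ≤ 0 :=
    div_nonpos_of_nonpos_of_nonneg hD (mul_pos h.len₂ h.len₃).le
  have hp : 0 < √(x₁ + x₃ + 2 * y₂) * √(x₁ + x₂ + 2 * y₃) :=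
    mul_pos (sqrt_pos.2 h.len₂) (sqrt_pos.2 h.len₃)
  have h3 : 1 ≤ |(x₁ + y₂ + y₃ - y₁) / (√(x₁ + x₃ + 2 * y₂) * √(x₁ + x₂ + 2 * y₃))| := by
    rw [← one_le_sq_iff_one_le_abs]; linarith
  rcases le_or_gt (x₁ + y₂ + y₃ - y₁) 0 with hn | hn
  · refine Or.inl ⟨hn, arccos_of_le_neg_one ?_⟩
    rw [abs_of_nonpos (div_nonpos_of_nonpos_of_nonneg hn hp.le)] at h3
    linarith
  · refine Or.inr ⟨hn, arccos_of_one_le ?_⟩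
    rwa [abs_of_pos (div_pos hn hp)] at h3

lemma triCos_mem (h : TriData x₁ x₂ x₃ y₁ y₂ y₃) (hD : 0 < triDisc x₁ x₂ x₃ y₁ y₂ y₃) :
    |(x₁ + y₂ + y₃ - y₁) / (√(x₁ + x₃ + 2 * y₂) * √(x₁ + x₂ + 2 * y₃))| < 1 := by
  have h1 := sq_triCos (y₁ := y₁) h.len₂ h.len₃
  have h2 : 0 < triDisc x₁ x₂ x₃ y₁ y₂ y₃ / ((x₁ + x₃ + 2 * y₂) * (x₁ + x₂ + 2 * y₃)) :=
    div_pos hD (mul_pos h.len₂ h.len₃)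
  rw [← sq_lt_one_iff_abs_lt_one]; linarith

lemma cos_triAngle (h : TriData x₁ x₂ x₃ y₁ y₂ y₃) (hD : 0 < triDisc x₁ x₂ x₃ y₁ y₂ y₃) :
    cos (triAngle x₁ x₂ x₃ y₁ y₂ y₃) =
      (x₁ + y₂ + y₃ - y₁) / (√(x₁ + x₃ + 2 * y₂) * √(x₁ + x₂ + 2 * y₃)) := by
  have := abs_lt.1 (triCos_mem h hD)
  exact cos_arccos this.1.le this.2.le

lemma sin_triAngle (h : TriData x₁ x₂ x₃ y₁ y₂ y₃) :
    sin (triAngle x₁ x₂ x₃ y₁ y₂ y₃) =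
      √(triDisc x₁ x₂ x₃ y₁ y₂ y₃) / (√(x₁ + x₃ + 2 * y₂) * √(x₁ + x₂ + 2 * y₃)) := by
  rw [triAngle, sin_arccos, sq_triCos h.len₂ h.len₃, sqrt_div' _ (mul_pos h.len₂ h.len₃).le,
    sqrt_mul h.len₂.le]

/-- The extended angles of a triangle sum to `π`. -/
lemma triAngle_sum (h : TriData x₁ x₂ x₃ y₁ y₂ y₃) :
    triAngle x₁ x₂ x₃ y₁ y₂ y₃ + triAngle x₂ x₃ x₁ y₂ y₃ y₁ + triAngle x₃ x₁ x₂ y₃ y₁ y₂ = π := by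
  have l1 := h.len₁
  have l2 := h.len₂
  have l3 := h.len₃
  rcases le_or_gt (triDisc x₁ x₂ x₃ y₁ y₂ y₃) 0 with hD | hD
  · have e : triDisc x₁ x₂ x₃ y₁ y₂ y₃ = (x₁ + y₂ + y₃ - y₁) * (x₂ + y₃ + y₁ - y₂) +
        (x₁ + y₂ + y₃ - y₁) * (x₃ + y₁ + y₂ - y₃) + (x₂ + y₃ + y₁ - y₂) * (x₃ + y₁ + y₂ - y₃) := by
      unfold triDisc; ring
    have c1 := triAngle_of_disc_nonpos h hD
    have c2 := triAngle_of_disc_nonpos h.rotate (triDisc_rotate.trans_le hD)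
    have c3 := triAngle_of_disc_nonpos h.rotate.rotate
      ((triDisc_rotate.trans triDisc_rotate).trans_le hD)
    rcases c1 with ⟨n1, a1⟩ | ⟨n1, a1⟩ <;> rcases c2 with ⟨n2, a2⟩ | ⟨n2, a2⟩ <;>
      rcases c3 with ⟨n3, a3⟩ | ⟨n3, a3⟩ <;> rw [a1, a2, a3] <;> first
        | (exfalso; linarith)
        | (exfalso; linarith [mul_pos n1 n2, mul_pos n1 n3, mul_pos n2 n3])
        | ring
  · have hD2 : 0 < triDisc x₂ x₃ x₁ y₂ y₃ y₁ := by rwa [triDisc_rotate]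
    have hD3 : 0 < triDisc x₃ x₁ x₂ y₃ y₁ y₂ := by rwa [triDisc_rotate, triDisc_rotate]
    have e1 : x₃ + x₁ + 2 * y₂ = x₁ + x₃ + 2 * y₂ := by ring
    have e2 : x₃ + x₂ + 2 * y₁ = x₂ + x₃ + 2 * y₁ := by ring
    have e3 : x₂ + x₁ + 2 * y₃ = x₁ + x₂ + 2 * y₃ := by ring
    have s1 := sin_triAngle h
    have s2 := sin_triAngle h.rotate
    have k1 := cos_triAngle h hD
    have k2 := cos_triAngle h.rotate hD2
    have k3 := cos_triAngle h.rotate.rotate hD3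
    rw [triDisc_rotate] at s2
    rw [e3] at s2 k2
    rw [e1, e2] at k3
    have q1 := sqrt_pos.2 l1
    have q2 := sqrt_pos.2 l2
    have q3 := sqrt_pos.2 l3
    have r1 := sq_sqrt l1.le
    have r2 := sq_sqrt l2.le
    have r3 := sq_sqrt l3.le
    have rD := sq_sqrt hD.le
    have qD := sqrt_pos.2 hD
    set A1 := √(x₂ + x₃ + 2 * y₁)
    set A2 := √(x₁ + x₃ + 2 * y₂)
    set A3 := √(x₁ + x₂ + 2 * y₃)
    set Δ := √(triDisc x₁ x₂ x₃ y₁ y₂ y₃)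
    have hsin : 0 < sin (triAngle x₁ x₂ x₃ y₁ y₂ y₃ + triAngle x₂ x₃ x₁ y₂ y₃ y₁) := by
      rw [sin_add, s1, s2, k1, k2]
      have : Δ / (A2 * A3) * ((x₂ + y₃ + y₁ - y₂) / (A3 * A1)) +
          (x₁ + y₂ + y₃ - y₁) / (A2 * A3) * (Δ / (A3 * A1)) = Δ / (A1 * A2) := by
        have : (x₂ + y₃ + y₁ - y₂) + (x₁ + y₂ + y₃ - y₁) = A3 ^ 2 := by
          rw [r3]; ring
        field_simp
        linear_combination this
      rw [this]; positivity
    have hcos : cos (triAngle x₁ x₂ x₃ y₁ y₂ y₃ + triAngle x₂ x₃ x₁ y₂ y₃ y₁) =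
        cos (π - triAngle x₃ x₁ x₂ y₃ y₁ y₂) := by
      rw [cos_add, cos_pi_sub, s1, s2, k1, k2, k3]
      have : (x₁ + y₂ + y₃ - y₁) * (x₂ + y₃ + y₁ - y₂) - Δ ^ 2 =
          - (x₃ + y₁ + y₂ - y₃) * A3 ^ 2 := by
        rw [r3, rD, triDisc]; ring
      field_simp
      linear_combination this
    have b1 : 0 ≤ triAngle x₁ x₂ x₃ y₁ y₂ y₃ ∧ triAngle x₁ x₂ x₃ y₁ y₂ y₃ ≤ π :=
      ⟨arccos_nonneg _, arccos_le_pi _⟩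
    have b2 : 0 ≤ triAngle x₂ x₃ x₁ y₂ y₃ y₁ ∧ triAngle x₂ x₃ x₁ y₂ y₃ y₁ ≤ π :=
      ⟨arccos_nonneg _, arccos_le_pi _⟩
    have b3 : 0 ≤ triAngle x₃ x₁ x₂ y₃ y₁ y₂ ∧ triAngle x₃ x₁ x₂ y₃ y₁ y₂ ≤ π :=
      ⟨arccos_nonneg _, arccos_le_pi _⟩
    have hle : triAngle x₁ x₂ x₃ y₁ y₂ y₃ + triAngle x₂ x₃ x₁ y₂ y₃ y₁ ≤ π := by
      by_contra hcon
      push Not at hcon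
      have := sin_nonpos_of_nonpos_of_neg_pi_le
        (x := triAngle x₁ x₂ x₃ y₁ y₂ y₃ + triAngle x₂ x₃ x₁ y₂ y₃ y₁ - 2 * π)
        (by linarith) (by linarith)
      rw [sin_sub_two_pi] at this
      linarith
    have := injOn_cos ⟨by linarith, hle⟩ ⟨by linarith, by linarith⟩ hcos
    linarith

/-- Derivative of an angle along a curve of conformal factors with velocity `d`. -/
lemma hasDerivAt_triAngle {X₁ X₂ X₃ Y₁ Y₂ Y₃ : ℝ → ℝ} {d₁ d₂ d₃ s : ℝ}
    (hX₁ : HasDerivAt X₁ (2 * d₁ * X₁ s) s) (hX₂ : HasDerivAt X₂ (2 * d₂ * X₂ s) s)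
    (hX₃ : HasDerivAt X₃ (2 * d₃ * X₃ s) s) (hY₁ : HasDerivAt Y₁ ((d₂ + d₃) * Y₁ s) s)
    (hY₂ : HasDerivAt Y₂ ((d₃ + d₁) * Y₂ s) s) (hY₃ : HasDerivAt Y₃ ((d₁ + d₂) * Y₃ s) s)
    (h : TriData (X₁ s) (X₂ s) (X₃ s) (Y₁ s) (Y₂ s) (Y₃ s))
    (hD : 0 < triDisc (X₁ s) (X₂ s) (X₃ s) (Y₁ s) (Y₂ s) (Y₃ s)) :
    HasDerivAt (fun r => triAngle (X₁ r) (X₂ r) (X₃ r) (Y₁ r) (Y₂ r) (Y₃ r))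
      ((triCoeff (X₁ s) (X₂ s) (Y₁ s) (Y₂ s) (Y₃ s) / (X₁ s + X₂ s + 2 * Y₃ s) * (d₂ - d₁) +
        triCoeff (X₃ s) (X₁ s) (Y₃ s) (Y₁ s) (Y₂ s) / (X₃ s + X₁ s + 2 * Y₂ s) * (d₃ - d₁)) /
        √(triDisc (X₁ s) (X₂ s) (X₃ s) (Y₁ s) (Y₂ s) (Y₃ s))) s := by
  have hq := abs_lt.1 (triCos_mem h hD)
  have hs := sq_triCos (y₁ := Y₁ s) h.len₂ h.len₃
  have l2 := h.len₂
  have l3 := h.len₃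
  have D2 := ((hX₁.add hX₃).add (hY₂.const_mul 2)).sqrt l2.ne'
  have D3 := ((hX₁.add hX₂).add (hY₃.const_mul 2)).sqrt l3.ne'
  have Dn := ((hX₁.add hY₂).add hY₃).sub hY₁
  have hne : √(X₁ s + X₃ s + 2 * Y₂ s) * √(X₁ s + X₂ s + 2 * Y₃ s) ≠ 0 :=
    (mul_pos (sqrt_pos.2 l2) (sqrt_pos.2 l3)).ne'
  have Dq := Dn.div (D2.mul D3) hne
  have key := (hasDerivAt_arccos hq.1.ne' hq.2.ne).comp s Dq
  refine key.congr_deriv ?_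
  simp only [Pi.add_apply, Pi.sub_apply, Pi.mul_apply]
  rw [hs, sqrt_div' _ (mul_pos l2 l3).le, sqrt_mul l2.le]
  have q2 := sqrt_pos.2 l2
  have q3 := sqrt_pos.2 l3
  have qD := sqrt_pos.2 hD
  have r2 := sq_sqrt l2.le
  have r3 := sq_sqrt l3.le
  rw [show X₃ s + X₁ s + 2 * Y₂ s = X₁ s + X₃ s + 2 * Y₂ s by ring]
  rw [← r2, ← r3]
  simp only [sqrt_sq (sqrt_nonneg _)]
  set A2 := √(X₁ s + X₃ s + 2 * Y₂ s)
  set A3 := √(X₁ s + X₂ s + 2 * Y₃ s)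
  set Δ := √(triDisc (X₁ s) (X₂ s) (X₃ s) (Y₁ s) (Y₂ s) (Y₃ s))
  unfold triCoeff
  generalize X₁ s = x₁ at *
  generalize X₂ s = x₂ at *
  generalize X₃ s = x₃ at *
  generalize Y₁ s = y₁ at *
  generalize Y₂ s = y₂ at *
  generalize Y₃ s = y₃ at *
  have e2 : x₃ = A2 ^ 2 - x₁ - 2 * y₂ := by linarith
  have e3 : x₂ = A3 ^ 2 - x₁ - 2 * y₃ := by linarith
  clear_value A2 A3 Δ
  clear hs key Dq hne D2 D3 Dn hq h hD l2 l3 r2 r3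
  subst e2 e3
  field_simp
  ring

/-- The quadratic form given by the Jacobian of the angles is definite modulo scaling. -/
lemma triForm_pos (h : TriData x₁ x₂ x₃ y₁ y₂ y₃) (hD : 0 < triDisc x₁ x₂ x₃ y₁ y₂ y₃)
    (X Y : ℝ) :
    0 ≤ triCoeff x₁ x₂ y₁ y₂ y₃ / (x₁ + x₂ + 2 * y₃) * X ^ 2 +
      triCoeff x₂ x₃ y₂ y₃ y₁ / (x₂ + x₃ + 2 * y₁) * Y ^ 2 +
      triCoeff x₃ x₁ y₃ y₁ y₂ / (x₃ + x₁ + 2 * y₂) * (X + Y) ^ 2 ∧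
    (triCoeff x₁ x₂ y₁ y₂ y₃ / (x₁ + x₂ + 2 * y₃) * X ^ 2 +
      triCoeff x₂ x₃ y₂ y₃ y₁ / (x₂ + x₃ + 2 * y₁) * Y ^ 2 +
      triCoeff x₃ x₁ y₃ y₁ y₂ / (x₃ + x₁ + 2 * y₂) * (X + Y) ^ 2 = 0 → X = 0 ∧ Y = 0) := by
  have l1 := h.len₁
  have l2 : 0 < x₃ + x₁ + 2 * y₂ := by linarith [h.len₂]
  have l3 := h.len₃
  have hR := h.cubic
  have hB : 0 < triCoeff x₂ x₃ y₂ y₃ y₁ / (x₂ + x₃ + 2 * y₁) *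
        (triCoeff x₃ x₁ y₃ y₁ y₂ / (x₃ + x₁ + 2 * y₂)) +
      triCoeff x₂ x₃ y₂ y₃ y₁ / (x₂ + x₃ + 2 * y₁) *
        (triCoeff x₁ x₂ y₁ y₂ y₃ / (x₁ + x₂ + 2 * y₃)) +
      triCoeff x₃ x₁ y₃ y₁ y₂ / (x₃ + x₁ + 2 * y₂) *
        (triCoeff x₁ x₂ y₁ y₂ y₃ / (x₁ + x₂ + 2 * y₃)) := by
    refine pos_of_mul_pos_left (b := (x₂ + x₃ + 2 * y₁) * (x₃ + x₁ + 2 * y₂) *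
      (x₁ + x₂ + 2 * y₃)) ?_ (by positivity)
    have c1 := div_mul_cancel₀ (triCoeff x₂ x₃ y₂ y₃ y₁) l1.ne'
    have c2 := div_mul_cancel₀ (triCoeff x₃ x₁ y₃ y₁ y₂) l2.ne'
    have c3 := div_mul_cancel₀ (triCoeff x₁ x₂ y₁ y₂ y₃) l3.ne'
    have e : triCoeff x₂ x₃ y₂ y₃ y₁ * triCoeff x₃ x₁ y₃ y₁ y₂ * (x₁ + x₂ + 2 * y₃) +
        triCoeff x₂ x₃ y₂ y₃ y₁ * triCoeff x₁ x₂ y₁ y₂ y₃ * (x₃ + x₁ + 2 * y₂) +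
        triCoeff x₃ x₁ y₃ y₁ y₂ * triCoeff x₁ x₂ y₁ y₂ y₃ * (x₂ + x₃ + 2 * y₁) =
        triDisc x₁ x₂ x₃ y₁ y₂ y₃ * triCubic x₁ x₂ x₃ y₁ y₂ y₃ := by
      unfold triDisc triCubic triCoeff; ring
    refine (mul_pos hD hR).trans_eq ?_
    rw [← e]
    generalize triCoeff x₂ x₃ y₂ y₃ y₁ / (x₂ + x₃ + 2 * y₁) = b₁ at *
    generalize triCoeff x₃ x₁ y₃ y₁ y₂ / (x₃ + x₁ + 2 * y₂) = b₂ at *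
    generalize triCoeff x₁ x₂ y₁ y₂ y₃ / (x₁ + x₂ + 2 * y₃) = b₃ at *
    rw [← c1, ← c2, ← c3]; ring
  have hsum : triCoeff x₂ x₃ y₂ y₃ y₁ / (x₂ + x₃ + 2 * y₁) * (x₂ + x₃ + 2 * y₁) +
      triCoeff x₃ x₁ y₃ y₁ y₂ / (x₃ + x₁ + 2 * y₂) * (x₃ + x₁ + 2 * y₂) +
      triCoeff x₁ x₂ y₁ y₂ y₃ / (x₁ + x₂ + 2 * y₃) * (x₁ + x₂ + 2 * y₃) =
      triDisc x₁ x₂ x₃ y₁ y₂ y₃ := by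
    rw [div_mul_cancel₀ _ l1.ne', div_mul_cancel₀ _ l2.ne', div_mul_cancel₀ _ l3.ne']
    unfold triDisc triCoeff; ring
  have hdisc : triDisc x₁ x₂ x₃ y₁ y₂ y₃ =
    (x₃ + x₁ + 2 * y₂) * (x₁ + x₂ + 2 * y₃) - (x₁ + y₂ + y₃ - y₁) ^ 2 := by
    unfold triDisc; ring
  generalize triCoeff x₂ x₃ y₂ y₃ y₁ / (x₂ + x₃ + 2 * y₁) = b₁ at *
  generalize triCoeff x₃ x₁ y₃ y₁ y₂ / (x₃ + x₁ + 2 * y₂) = b₂ at *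
  generalize triCoeff x₁ x₂ y₁ y₂ y₃ / (x₁ + x₂ + 2 * y₃) = b₃ at *
  generalize triDisc x₁ x₂ x₃ y₁ y₂ y₃ = D at *
  have hβ : 0 < b₂ + b₃ := by
    have hq : 0 ≤ (x₃ + x₁ + 2 * y₂) * b₂ ^ 2 + (x₁ + x₂ + 2 * y₃) * b₃ ^ 2 +
        2 * (x₁ + y₂ + y₃ - y₁) * b₂ * b₃ := by
      refine nonneg_of_mul_nonneg_right (a := x₃ + x₁ + 2 * y₂) ?_ l2
      have : (x₃ + x₁ + 2 * y₂) * ((x₃ + x₁ + 2 * y₂) * b₂ ^ 2 + (x₁ + x₂ + 2 * y₃) * b₃ ^ 2 +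
        2 * (x₁ + y₂ + y₃ - y₁) * b₂ * b₃) =
        ((x₃ + x₁ + 2 * y₂) * b₂ + (x₁ + y₂ + y₃ - y₁) * b₃) ^ 2 + D * b₃ ^ 2 := by
        rw [hdisc]; ring
      rw [this]; positivity
    refine pos_of_mul_pos_left (b := D) ?_ hD.le
    have : (b₂ + b₃) * D = (x₂ + x₃ + 2 * y₁) * (b₁ * b₂ + b₁ * b₃ + b₂ * b₃) +
        ((x₃ + x₁ + 2 * y₂) * b₂ ^ 2 + (x₁ + x₂ + 2 * y₃) * b₃ ^ 2 +
        2 * (x₁ + y₂ + y₃ - y₁) * b₂ * b₃) := by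
      rw [← hsum]; ring
    rw [this]
    have := mul_pos l1 hB
    linarith
  have key : (b₂ + b₃) * (b₃ * X ^ 2 + b₁ * Y ^ 2 + b₂ * (X + Y) ^ 2) =
      ((b₂ + b₃) * X + b₂ * Y) ^ 2 + (b₁ * b₂ + b₁ * b₃ + b₂ * b₃) * Y ^ 2 := by ring
  refine ⟨nonneg_of_mul_nonneg_right (a := b₂ + b₃) (by rw [key]; positivity) hβ, fun h0 => ?_⟩
  rw [h0, mul_zero] at key
  have hY : (b₁ * b₂ + b₁ * b₃ + b₂ * b₃) * Y ^ 2 = 0 :=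
    le_antisymm (by linarith [sq_nonneg ((b₂ + b₃) * X + b₂ * Y)]) (by positivity)
  have hY0 : Y = 0 := by simpa [hB.ne'] using hY
  subst hY0
  have hX : (b₂ + b₃) * X = 0 := by
    have : ((b₂ + b₃) * X) ^ 2 = 0 := by linear_combination -key
    simpa using this
  exact ⟨(mul_eq_zero.1 hX).resolve_left hβ.ne', rfl⟩

end Triangle

/-- The structure conditions on the weights of a single triangle. -/
structure TriWeights (e₁ e₂ e₃ h₁ h₂ h₃ : ℝ) : Prop where
  eps₁ : e₁ = 0 ∨ e₁ = 1
  eps₂ : e₂ = 0 ∨ e₂ = 1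
  eps₃ : e₃ = 0 ∨ e₃ = 1
  edge₁ : 0 < e₂ * e₃ + h₁
  edge₂ : 0 < e₃ * e₁ + h₂
  edge₃ : 0 < e₁ * e₂ + h₃
  face₁ : 0 ≤ e₁ * h₁ + h₂ * h₃
  face₂ : 0 ≤ e₂ * h₂ + h₃ * h₁
  face₃ : 0 ≤ e₃ * h₃ + h₁ * h₂

/-- The extended angle at the first vertex of a weighted triangle with conformal factors
`u₁, u₂, u₃`. -/
noncomputable def confAngle (e₁ e₂ e₃ h₁ h₂ h₃ u₁ u₂ u₃ : ℝ) : ℝ :=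
  triAngle (e₁ * exp (2 * u₁)) (e₂ * exp (2 * u₂)) (e₃ * exp (2 * u₃))
    (h₁ * exp (u₂ + u₃)) (h₂ * exp (u₃ + u₁)) (h₃ * exp (u₁ + u₂))

section Weights

variable {e₁ e₂ e₃ h₁ h₂ h₃ : ℝ}

lemma TriWeights.rotate (h : TriWeights e₁ e₂ e₃ h₁ h₂ h₃) : TriWeights e₂ e₃ e₁ h₂ h₃ h₁ :=
  ⟨h.eps₂, h.eps₃, h.eps₁, h.edge₂, h.edge₃, h.edge₁, h.face₂, h.face₃, h.face₁⟩

lemma TriWeights.swap (h : TriWeights e₁ e₂ e₃ h₁ h₂ h₃) : TriWeights e₁ e₃ e₂ h₁ h₃ h₂ :=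
  ⟨h.eps₁, h.eps₃, h.eps₂, by linarith [h.edge₁], by linarith [h.edge₃], by linarith [h.edge₂],
    by linarith [h.face₁], by linarith [h.face₃], by linarith [h.face₂]⟩

lemma confAngle_swap (e₁ e₂ e₃ h₁ h₂ h₃ u₁ u₂ u₃ : ℝ) :
    confAngle e₁ e₃ e₂ h₁ h₃ h₂ u₁ u₃ u₂ = confAngle e₁ e₂ e₃ h₁ h₂ h₃ u₁ u₂ u₃ := by
  unfold confAngle triAngle
  rw [mul_comm (√_), add_comm u₃ u₂, add_comm u₂ u₁, add_comm u₁ u₃]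
  congr 2
  ring

lemma sqLength_pos {e e' h : ℝ} (he : e = 0 ∨ e = 1) (he' : e' = 0 ∨ e' = 1)
    (hh : 0 < e * e' + h) {w w' : ℝ} (hw : 0 < w) (hw' : 0 < w') :
    0 < e * w ^ 2 + e' * w' ^ 2 + 2 * (h * (w * w')) := by
  have hp := mul_pos hw hw'
  rcases he with rfl | rfl <;> rcases he' with rfl | rfl
  · have := mul_pos (show 0 < h by linarith) hp
    linarith
  · have := mul_pos (show 0 < h by linarith) hp
    nlinarith [sq_nonneg w']
  · have := mul_pos (show 0 < h by linarith) hp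
    nlinarith [sq_nonneg w]
  · have := mul_pos (show 0 < 1 + h by linarith) hp
    nlinarith [sq_nonneg (w - w')]

lemma triCubic_pos_of_nonneg (h : TriWeights e₁ e₂ e₃ h₁ h₂ h₃) {w₁ w₂ w₃ : ℝ} (k₁ : 0 < w₁)
    (k₂ : 0 < w₂) (k₃ : 0 < w₃) (hd : (e₁ = 0) ∨ h₁ < 0) :
    0 < triCubic (e₁ * w₁ ^ 2) (e₂ * w₂ ^ 2) (e₃ * w₃ ^ 2) (h₁ * (w₂ * w₃)) (h₂ * (w₃ * w₁))
      (h₃ * (w₁ * w₂)) := by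
  have l1 := sqLength_pos h.eps₂ h.eps₃ h.edge₁ k₂ k₃
  have p1 : 0 ≤ e₁ := by rcases h.eps₁ with e | e <;> simp [e]
  have p2 : 0 ≤ e₂ := by rcases h.eps₂ with e | e <;> simp [e]
  have p3 : 0 ≤ e₃ := by rcases h.eps₃ with e | e <;> simp [e]
  have s1 : (e₁ * w₁ ^ 2) * (h₁ * (w₂ * w₃)) + (h₂ * (w₃ * w₁)) * (h₃ * (w₁ * w₂)) =
    (e₁ * h₁ + h₂ * h₃) * (w₁ ^ 2 * w₂ * w₃) := by ring
  have s2 : (e₂ * w₂ ^ 2) * (h₂ * (w₃ * w₁)) + (h₁ * (w₂ * w₃)) * (h₃ * (w₁ * w₂)) =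
    (e₂ * h₂ + h₃ * h₁) * (w₂ ^ 2 * w₃ * w₁) := by ring
  have s3 : (e₃ * w₃ ^ 2) * (h₃ * (w₁ * w₂)) + (h₁ * (w₂ * w₃)) * (h₂ * (w₃ * w₁)) =
    (e₃ * h₃ + h₁ * h₂) * (w₃ ^ 2 * w₁ * w₂) := by ring
  have f1 := h.face₁
  have f2 := h.face₂
  have f3 := h.face₃
  unfold triCubic
  rw [s1, s2, s3]
  have t2 : 0 ≤ (e₁ * w₁ ^ 2 + e₃ * w₃ ^ 2) * ((e₂ * h₂ + h₃ * h₁) * (w₂ ^ 2 * w₃ * w₁)) := by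
    positivity
  have t3 : 0 ≤ (e₁ * w₁ ^ 2 + e₂ * w₂ ^ 2) * ((e₃ * h₃ + h₁ * h₂) * (w₃ ^ 2 * w₁ * w₂)) := by
    positivity
  rcases h.eps₁ with e | e
  · subst e
    have q2 : 0 < h₂ := by linarith [h.edge₂]
    have q3 : 0 < h₃ := by linarith [h.edge₃]
    have : 0 < (0 * h₁ + h₂ * h₃) * (w₁ ^ 2 * w₂ * w₃) *
      (e₂ * w₂ ^ 2 + e₃ * w₃ ^ 2 + 2 * (h₁ * (w₂ * w₃))) := by
      refine mul_pos ?_ l1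
      rw [zero_mul, zero_add]; positivity
    linarith
  · have hneg : h₁ < 0 := hd.resolve_left (by rw [e]; norm_num)
    have h23 : e₂ = 1 ∧ e₃ = 1 := by
      have := h.edge₁
      rcases h.eps₂ with a | a <;> rcases h.eps₃ with b | b <;> subst a b <;>
        first | exact ⟨rfl, rfl⟩ | linarith
    obtain ⟨a, b⟩ := h23
    have hgt : -1 < h₁ := by have := h.edge₁; rw [a, b] at this; linarith
    have : 0 < 2 * (e₁ * w₁ ^ 2) * (e₂ * w₂ ^ 2 * (e₃ * w₃ ^ 2) - (h₁ * (w₂ * w₃)) ^ 2) := by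
      rw [e, a, b]
      have : 1 * w₂ ^ 2 * (1 * w₃ ^ 2) - (h₁ * (w₂ * w₃)) ^ 2 =
        ((1 - h₁) * (1 + h₁)) * (w₂ * w₃) ^ 2 := by ring
      rw [this]
      have i1 : 0 < 1 - h₁ := by linarith
      have i2 : 0 < 1 + h₁ := by linarith
      positivity
    have : 0 ≤ (e₁ * h₁ + h₂ * h₃) * (w₁ ^ 2 * w₂ * w₃) *
      (e₂ * w₂ ^ 2 + e₃ * w₃ ^ 2 + 2 * (h₁ * (w₂ * w₃))) := by positivity
    linarith

lemma triCubic_pos (h : TriWeights e₁ e₂ e₃ h₁ h₂ h₃) {w₁ w₂ w₃ : ℝ} (k₁ : 0 < w₁)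
    (k₂ : 0 < w₂) (k₃ : 0 < w₃) :
    0 < triCubic (e₁ * w₁ ^ 2) (e₂ * w₂ ^ 2) (e₃ * w₃ ^ 2) (h₁ * (w₂ * w₃)) (h₂ * (w₃ * w₁))
      (h₃ * (w₁ * w₂)) := by
  by_cases c1 : e₁ = 0 ∨ h₁ < 0
  · exact triCubic_pos_of_nonneg h k₁ k₂ k₃ c1
  by_cases c2 : e₂ = 0 ∨ h₂ < 0
  · rw [← triCubic_rotate]
    exact triCubic_pos_of_nonneg h.rotate k₂ k₃ k₁ c2
  by_cases c3 : e₃ = 0 ∨ h₃ < 0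
  · rw [← triCubic_rotate, ← triCubic_rotate]
    exact triCubic_pos_of_nonneg h.rotate.rotate k₃ k₁ k₂ c3
  push Not at c1 c2 c3
  obtain ⟨a1, b1⟩ := c1
  obtain ⟨a2, b2⟩ := c2
  obtain ⟨a3, b3⟩ := c3
  have a1 := h.eps₁.resolve_left a1
  have a2 := h.eps₂.resolve_left a2
  have a3 := h.eps₃.resolve_left a3
  subst a1 a2 a3
  have : triCubic (1 * w₁ ^ 2) (1 * w₂ ^ 2) (1 * w₃ ^ 2) (h₁ * (w₂ * w₃)) (h₂ * (w₃ * w₁))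
      (h₃ * (w₁ * w₂)) = 2 * (w₁ * w₂ * w₃) ^ 2 * (1 + h₁ * h₂ * h₃) +
      w₁ ^ 2 * ((h₂ + h₃ * h₁) * (w₂ ^ 2 * w₃ * w₁) + (h₃ + h₁ * h₂) * (w₃ ^ 2 * w₁ * w₂)) +
      w₂ ^ 2 * ((h₁ + h₂ * h₃) * (w₁ ^ 2 * w₂ * w₃) + (h₃ + h₁ * h₂) * (w₃ ^ 2 * w₁ * w₂)) +
      w₃ ^ 2 * ((h₁ + h₂ * h₃) * (w₁ ^ 2 * w₂ * w₃) + (h₂ + h₃ * h₁) * (w₂ ^ 2 * w₃ * w₁)) := by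
    unfold triCubic; ring
  rw [this]
  positivity

lemma exp_two_mul (x : ℝ) : exp (2 * x) = exp x ^ 2 := by
  rw [sq, ← exp_add]; ring_nf

lemma TriWeights.triData (h : TriWeights e₁ e₂ e₃ h₁ h₂ h₃) (u₁ u₂ u₃ : ℝ) :
    TriData (e₁ * exp (2 * u₁)) (e₂ * exp (2 * u₂)) (e₃ * exp (2 * u₃))
      (h₁ * exp (u₂ + u₃)) (h₂ * exp (u₃ + u₁)) (h₃ * exp (u₁ + u₂)) := by
  simp only [exp_two_mul, exp_add]
  have k₁ := exp_pos u₁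
  have k₂ := exp_pos u₂
  have k₃ := exp_pos u₃
  refine ⟨sqLength_pos h.eps₂ h.eps₃ h.edge₁ k₂ k₃, ?_,
    sqLength_pos h.eps₁ h.eps₂ h.edge₃ k₁ k₂, triCubic_pos h k₁ k₂ k₃⟩
  have := sqLength_pos h.eps₃ h.eps₁ h.edge₂ k₃ k₁
  linarith

lemma continuous_confAngle (h : TriWeights e₁ e₂ e₃ h₁ h₂ h₃) {β : Type*} [TopologicalSpace β]
    {u₁ u₂ u₃ : β → ℝ} (c₁ : Continuous u₁) (c₂ : Continuous u₂) (c₃ : Continuous u₃) :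
    Continuous fun b => confAngle e₁ e₂ e₃ h₁ h₂ h₃ (u₁ b) (u₂ b) (u₃ b) := by
  unfold confAngle triAngle
  refine continuous_arccos.comp (Continuous.div (by fun_prop) (by fun_prop) fun b => ?_)
  have hd := h.triData (u₁ b) (u₂ b) (u₃ b)
  exact (mul_pos (sqrt_pos.2 hd.len₂) (sqrt_pos.2 hd.len₃)).ne'

lemma differentiableAt_confAngle (h : TriWeights e₁ e₂ e₃ h₁ h₂ h₃) {E : Type*}
    [NormedAddCommGroup E] [NormedSpace ℝ E] {u₁ u₂ u₃ : E → ℝ} {b : E}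
    (c₁ : DifferentiableAt ℝ u₁ b) (c₂ : DifferentiableAt ℝ u₂ b) (c₃ : DifferentiableAt ℝ u₃ b)
    (hD : 0 < triDisc (e₁ * exp (2 * u₁ b)) (e₂ * exp (2 * u₂ b)) (e₃ * exp (2 * u₃ b))
      (h₁ * exp (u₂ b + u₃ b)) (h₂ * exp (u₃ b + u₁ b)) (h₃ * exp (u₁ b + u₂ b))) :
    DifferentiableAt ℝ (fun b => confAngle e₁ e₂ e₃ h₁ h₂ h₃ (u₁ b) (u₂ b) (u₃ b)) b := by
  have hd := h.triData (u₁ b) (u₂ b) (u₃ b)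
  have hq := abs_lt.1 (triCos_mem hd hD)
  have n : DifferentiableAt ℝ (fun b => e₁ * exp (2 * u₁ b) + h₂ * exp (u₃ b + u₁ b) +
      h₃ * exp (u₁ b + u₂ b) - h₁ * exp (u₂ b + u₃ b)) b := by fun_prop
  have d₂ : DifferentiableAt ℝ (fun b => √(e₁ * exp (2 * u₁ b) + e₃ * exp (2 * u₃ b) +
      2 * (h₂ * exp (u₃ b + u₁ b)))) b := DifferentiableAt.sqrt (by fun_prop) hd.len₂.ne'
  have d₃ : DifferentiableAt ℝ (fun b => √(e₁ * exp (2 * u₁ b) + e₂ * exp (2 * u₂ b) +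
      2 * (h₃ * exp (u₁ b + u₂ b)))) b := DifferentiableAt.sqrt (by fun_prop) hd.len₃.ne'
  have q := n.fun_mul ((d₂.fun_mul d₃).fun_inv
    (mul_pos (sqrt_pos.2 hd.len₂) (sqrt_pos.2 hd.len₃)).ne')
  simp only [← div_eq_mul_inv] at q
  exact DifferentiableAt.comp (g := arccos) b (differentiableAt_arccos.2 ⟨hq.1.ne', hq.2.ne⟩) q

/-- Along a ray of conformal factors, the pairing of the angles with the velocity either is
degenerate or is nonincreasing, strictly unless the velocity is constant. -/
lemma confAngle_ray (h : TriWeights e₁ e₂ e₃ h₁ h₂ h₃) (u₁ u₂ u₃ d₁ d₂ d₃ s : ℝ)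
    (hD : 0 < triDisc (e₁ * exp (2 * (u₁ + s * d₁))) (e₂ * exp (2 * (u₂ + s * d₂)))
      (e₃ * exp (2 * (u₃ + s * d₃))) (h₁ * exp (u₂ + s * d₂ + (u₃ + s * d₃)))
      (h₂ * exp (u₃ + s * d₃ + (u₁ + s * d₁))) (h₃ * exp (u₁ + s * d₁ + (u₂ + s * d₂)))) :
    ∃ g' ≤ 0, HasDerivAt (fun r =>
      d₁ * confAngle e₁ e₂ e₃ h₁ h₂ h₃ (u₁ + r * d₁) (u₂ + r * d₂) (u₃ + r * d₃) +
      d₂ * confAngle e₂ e₃ e₁ h₂ h₃ h₁ (u₂ + r * d₂) (u₃ + r * d₃) (u₁ + r * d₁) +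
      d₃ * confAngle e₃ e₁ e₂ h₃ h₁ h₂ (u₃ + r * d₃) (u₁ + r * d₁) (u₂ + r * d₂)) g' s ∧
      (g' = 0 → d₁ = d₂ ∧ d₂ = d₃) := by
  have hexp (e u d : ℝ) : HasDerivAt (fun r => e * exp (2 * (u + r * d)))
      (2 * d * (e * exp (2 * (u + s * d)))) s := by
    have := ((((hasDerivAt_id s).mul_const d).const_add u).const_mul 2).exp.const_mul e
    exact this.congr_deriv (by simp only [id]; ring)
  have hexp2 (e u d v c : ℝ) : HasDerivAt (fun r => e * exp (u + r * d + (v + r * c)))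
      ((d + c) * (e * exp (u + s * d + (v + s * c)))) s := by
    have := ((((hasDerivAt_id s).mul_const d).const_add u).add
      (((hasDerivAt_id s).mul_const c).const_add v)).exp.const_mul e
    exact this.congr_deriv (by simp only [id, Pi.add_apply]; ring)
  have T := h.triData (u₁ + s * d₁) (u₂ + s * d₂) (u₃ + s * d₃)
  have D1 := hasDerivAt_triAngle (hexp e₁ u₁ d₁) (hexp e₂ u₂ d₂) (hexp e₃ u₃ d₃)
    (hexp2 h₁ u₂ d₂ u₃ d₃) (hexp2 h₂ u₃ d₃ u₁ d₁) (hexp2 h₃ u₁ d₁ u₂ d₂) T hD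
  have D2 := hasDerivAt_triAngle (hexp e₂ u₂ d₂) (hexp e₃ u₃ d₃) (hexp e₁ u₁ d₁)
    (hexp2 h₂ u₃ d₃ u₁ d₁) (hexp2 h₃ u₁ d₁ u₂ d₂) (hexp2 h₁ u₂ d₂ u₃ d₃) T.rotate
    (hD.trans_eq triDisc_rotate.symm)
  have D3 := hasDerivAt_triAngle (hexp e₃ u₃ d₃) (hexp e₁ u₁ d₁) (hexp e₂ u₂ d₂)
    (hexp2 h₃ u₁ d₁ u₂ d₂) (hexp2 h₁ u₂ d₂ u₃ d₃) (hexp2 h₂ u₃ d₃ u₁ d₁) T.rotate.rotate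
    (hD.trans_eq (triDisc_rotate.trans triDisc_rotate).symm)
  have F := triForm_pos T hD (d₁ - d₂) (d₂ - d₃)
  rw [triDisc_rotate] at D2
  rw [triDisc_rotate.trans triDisc_rotate] at D3
  have D := ((D1.const_mul d₁).add (D2.const_mul d₂)).add (D3.const_mul d₃)
  have hs := sqrt_pos.2 hD
  generalize √(triDisc _ _ _ _ _ _) = Δ at *
  generalize triCoeff (e₁ * exp (2 * (u₁ + s * d₁))) _ _ _ _ / _ = A at *
  generalize triCoeff (e₂ * exp (2 * (u₂ + s * d₂))) _ _ _ _ / _ = B at *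
  generalize triCoeff (e₃ * exp (2 * (u₃ + s * d₃))) _ _ _ _ / _ = C at *
  refine ⟨-((A * (d₁ - d₂) ^ 2 + B * (d₂ - d₃) ^ 2 + C * (d₁ - d₂ + (d₂ - d₃)) ^ 2) / Δ),
    neg_nonpos.2 (div_nonneg F.1 hs.le), D.congr_deriv ?_, fun h0 => ?_⟩
  · ring
  · have := F.2 ((div_eq_zero_iff.1 (neg_eq_zero.1 h0)).resolve_right hs.ne')
    exact ⟨by linarith [this.1], by linarith [this.2]⟩

end Weights

section Asymptotics

variable {e₁ e₂ e₃ h₁ h₂ h₃ : ℝ}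

lemma confAngle_sum (h : TriWeights e₁ e₂ e₃ h₁ h₂ h₃) (u₁ u₂ u₃ : ℝ) :
    confAngle e₁ e₂ e₃ h₁ h₂ h₃ u₁ u₂ u₃ + confAngle e₂ e₃ e₁ h₂ h₃ h₁ u₂ u₃ u₁ +
      confAngle e₃ e₁ e₂ h₃ h₁ h₂ u₃ u₁ u₂ = π :=
  triAngle_sum (h.triData u₁ u₂ u₃)

lemma confAngle_nonneg (e₁ e₂ e₃ h₁ h₂ h₃ u₁ u₂ u₃ : ℝ) :
    0 ≤ confAngle e₁ e₂ e₃ h₁ h₂ h₃ u₁ u₂ u₃ :=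
  arccos_nonneg _

lemma confAngle_le_pi (e₁ e₂ e₃ h₁ h₂ h₃ u₁ u₂ u₃ : ℝ) :
    confAngle e₁ e₂ e₃ h₁ h₂ h₃ u₁ u₂ u₃ ≤ π :=
  arccos_le_pi _

/-- A conformal angle through squared lengths rescaled by arbitrary positive factors. -/
lemma confAngle_eq_of_scale {p q u₁ u₂ u₃ n X Y : ℝ} (hp : 0 < p) (hq : 0 < q)
    (hn : e₁ * exp (2 * u₁) + h₂ * exp (u₃ + u₁) + h₃ * exp (u₁ + u₂) - h₁ * exp (u₂ + u₃) =
      p * q * n)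
    (hX : e₁ * exp (2 * u₁) + e₃ * exp (2 * u₃) + 2 * (h₂ * exp (u₃ + u₁)) = p ^ 2 * X)
    (hY : e₁ * exp (2 * u₁) + e₂ * exp (2 * u₂) + 2 * (h₃ * exp (u₁ + u₂)) = q ^ 2 * Y) :
    confAngle e₁ e₂ e₃ h₁ h₂ h₃ u₁ u₂ u₃ = arccos (n / (√X * √Y)) := by
  unfold confAngle triAngle
  rw [hn, hX, hY, sqrt_mul (sq_nonneg _), sqrt_mul (sq_nonneg _), sqrt_sq hp.le, sqrt_sq hq.le]
  congr 1
  rw [show p * √X * (q * √Y) = p * q * (√X * √Y) by ring]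
  exact mul_div_mul_left _ _ (mul_pos hp hq).ne'

lemma confAngle_eq_low (e₁ e₂ e₃ h₁ h₂ h₃ u₁ u₂ u₃ : ℝ) :
    confAngle e₁ e₂ e₃ h₁ h₂ h₃ u₁ u₂ u₃ =
      arccos ((e₁ * (exp (u₁ - u₂) * exp (u₁ - u₃)) + h₂ * exp (u₁ - u₂) + h₃ * exp (u₁ - u₃) -
        h₁) / (√(e₁ * exp (u₁ - u₃) ^ 2 + e₃ + 2 * (h₂ * exp (u₁ - u₃))) *
          √(e₁ * exp (u₁ - u₂) ^ 2 + e₂ + 2 * (h₃ * exp (u₁ - u₂))))) := by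
  have k₂ := (exp_pos u₂).ne'
  have k₃ := (exp_pos u₃).ne'
  refine confAngle_eq_of_scale (exp_pos u₃) (exp_pos u₂) ?_ ?_ ?_ <;>
  · simp only [exp_two_mul, exp_add, exp_sub]
    field_simp
    try ring

lemma confAngle_eq_high (e₁ e₂ e₃ h₁ h₂ h₃ u₁ u₂ u₃ : ℝ) :
    confAngle e₁ e₂ e₃ h₁ h₂ h₃ u₁ u₂ u₃ =
      arccos ((e₁ + h₂ * exp (u₃ - u₁) + h₃ * exp (u₂ - u₁) -
        h₁ * (exp (u₂ - u₁) * exp (u₃ - u₁))) /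
        (√(e₁ + e₃ * exp (u₃ - u₁) ^ 2 + 2 * (h₂ * exp (u₃ - u₁))) *
          √(e₁ + e₂ * exp (u₂ - u₁) ^ 2 + 2 * (h₃ * exp (u₂ - u₁))))) := by
  have k₁ := (exp_pos u₁).ne'
  refine confAngle_eq_of_scale (exp_pos u₁) (exp_pos u₁) ?_ ?_ ?_ <;>
  · simp only [exp_two_mul, exp_add, exp_sub]
    field_simp
    try ring

variable {β : Type*} {l : Filter β} {u₁ u₂ u₃ : β → ℝ}

lemma tendsto_exp_sub_zero {u v : β → ℝ} (h : Tendsto (fun b => v b - u b) l atTop) :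
    Tendsto (fun b => exp (u b - v b)) l (𝓝 0) := by
  refine tendsto_exp_atBot.comp ?_
  have := tendsto_neg_atTop_atBot.comp h
  refine this.congr fun b => ?_
  simp

lemma exists_tendsto_confAngle_low (h : TriWeights e₁ e₂ e₃ h₁ h₂ h₃)
    (h₁₂ : Tendsto (fun b => u₂ b - u₁ b) l atTop)
    (h₁₃ : Tendsto (fun b => u₃ b - u₁ b) l atTop) :
    ∃ θ, Tendsto (fun b => confAngle e₁ e₂ e₃ h₁ h₂ h₃ (u₁ b) (u₂ b) (u₃ b)) l (𝓝 θ) := by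
  have ta := tendsto_exp_sub_zero h₁₂
  have tb := tendsto_exp_sub_zero h₁₃
  have cn : Continuous fun x : ℝ × ℝ => e₁ * (x.1 * x.2) + h₂ * x.1 + h₃ * x.2 - h₁ := by
    fun_prop
  have cd : Continuous fun x : ℝ × ℝ => √(e₁ * x.2 ^ 2 + e₃ + 2 * (h₂ * x.2)) *
      √(e₁ * x.1 ^ 2 + e₂ + 2 * (h₃ * x.1)) := by fun_prop
  have tn := (cn.tendsto (0, 0)).comp (ta.prodMk_nhds tb)
  have td := (cd.tendsto (0, 0)).comp (ta.prodMk_nhds tb)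
  have pd : ∀ b, 0 < √(e₁ * exp (u₁ b - u₃ b) ^ 2 + e₃ + 2 * (h₂ * exp (u₁ b - u₃ b))) *
      √(e₁ * exp (u₁ b - u₂ b) ^ 2 + e₂ + 2 * (h₃ * exp (u₁ b - u₂ b))) := fun b => by
    have s2 := sqLength_pos h.eps₃ h.eps₁ h.edge₂ one_pos (exp_pos (u₁ b - u₃ b))
    have s3 := sqLength_pos h.eps₁ h.eps₂ h.edge₃ (exp_pos (u₁ b - u₂ b)) one_pos
    exact mul_pos (sqrt_pos.2 (by linarith)) (sqrt_pos.2 (by linarith))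
  simp only [confAngle_eq_low]
  by_cases he : e₂ = 1 ∧ e₃ = 1
  · obtain ⟨rfl, rfl⟩ := he
    exact ⟨_, (continuous_arccos.tendsto _).comp (tn.div td (by simp))⟩
  · have he : e₂ * e₃ = 0 := by
      rcases h.eps₂ with a | a
      · simp [a]
      · rcases h.eps₃ with b | b
        · simp [b]
        · exact absurd ⟨a, b⟩ he
    have hh : 0 < h₁ := by linarith [h.edge₁]
    have z : √(e₁ * 0 ^ 2 + e₃ + 2 * (h₂ * 0)) * √(e₁ * 0 ^ 2 + e₂ + 2 * (h₃ * 0)) = 0 := by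
      rcases mul_eq_zero.1 he with a | a <;> simp [a]
    have tinv := (tendsto_inv_nhdsGT_zero (𝕜 := ℝ)).comp
      (tendsto_nhdsWithin_iff.2 ⟨z ▸ td, Eventually.of_forall pd⟩)
    have tq := tn.neg_mul_atTop (by simpa using hh) tinv
    refine ⟨π, tendsto_nhds_of_eventually_eq ?_⟩
    filter_upwards [tq.eventually_le_atBot (-1)] with b hb
    refine arccos_of_le_neg_one ?_
    rw [div_eq_mul_inv]
    exact hb

lemma tendsto_confAngle_high (h : TriWeights e₁ e₂ e₃ h₁ h₂ h₃)
    (h₂₁ : Tendsto (fun b => u₁ b - u₂ b) l atTop)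
    (h₃₁ : Tendsto (fun b => u₁ b - u₃ b) l atTop) :
    Tendsto (fun b => confAngle e₁ e₂ e₃ h₁ h₂ h₃ (u₁ b) (u₂ b) (u₃ b)) l (𝓝 0) := by
  have tc := tendsto_exp_sub_zero h₂₁
  have td := tendsto_exp_sub_zero h₃₁
  simp only [confAngle_eq_high]
  rcases h.eps₁ with rfl | rfl
  · have p2 : 0 < h₂ := by linarith [h.edge₂]
    have p3 : 0 < h₃ := by linarith [h.edge₃]
    have cn : Continuous fun x : ℝ × ℝ => 2 * (√h₂ * √h₃) - h₁ * (√x.1 * √x.2) := by fun_prop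
    have cd : Continuous fun x : ℝ × ℝ => √(2 * h₂ + e₃ * x.2) * √(2 * h₃ + e₂ * x.1) := by
      fun_prop
    have tn := (cn.tendsto (0, 0)).comp (tc.prodMk_nhds td)
    have td := (cd.tendsto (0, 0)).comp (tc.prodMk_nhds td)
    have hne : √(2 * h₂ + e₃ * 0) * √(2 * h₃ + e₂ * 0) ≠ 0 :=
      (mul_pos (sqrt_pos.2 (by linarith)) (sqrt_pos.2 (by linarith))).ne'
    have t := (continuous_arccos.tendsto _).comp (tn.div td hne)
    have e : (2 * (√h₂ * √h₃) - h₁ * (√0 * √0)) / (√(2 * h₂ + e₃ * 0) * √(2 * h₃ + e₂ * 0)) =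
        1 := by
      rw [div_eq_one_iff_eq hne]
      have : √2 * √2 = 2 := mul_self_sqrt (by norm_num)
      rw [sqrt_zero, mul_zero, mul_zero, mul_zero, mul_zero, add_zero, add_zero, sub_zero,
        sqrt_mul (by norm_num), sqrt_mul (by norm_num)]
      linear_combination -(√h₂ * √h₃) * this
    rw [e, arccos_one] at t
    refine squeeze_zero (fun _ => arccos_nonneg _) (fun b => ?_) t
    refine arccos_le_arccos ?_
    simp only [Function.comp, Pi.div_apply]
    set c := exp (u₂ b - u₁ b)
    set d := exp (u₃ b - u₁ b)
    have pc : 0 < c := exp_pos _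
    have pd : 0 < d := exp_pos _
    have n2 : 0 ≤ e₂ := by rcases h.eps₂ with a | a <;> simp [a]
    have n3 : 0 ≤ e₃ := by rcases h.eps₃ with a | a <;> simp [a]
    have x2 : 0 < 2 * h₂ + e₃ * d := by positivity
    have x3 : 0 < 2 * h₃ + e₂ * c := by positivity
    rw [show 0 + e₃ * d ^ 2 + 2 * (h₂ * d) = d * (2 * h₂ + e₃ * d) by ring,
      show 0 + e₂ * c ^ 2 + 2 * (h₃ * c) = c * (2 * h₃ + e₂ * c) by ring, sqrt_mul pd.le,
      sqrt_mul pc.le]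
    have q2 := sqrt_pos.2 x2
    have q3 := sqrt_pos.2 x3
    have qc := sqrt_pos.2 pc
    have qd := sqrt_pos.2 pd
    rw [div_le_div_iff₀ (mul_pos q2 q3) (by positivity)]
    have key : (2 * (√h₂ * √h₃) - h₁ * (√c * √d)) * (√d * √c) ≤
        0 + h₂ * d + h₃ * c - h₁ * (c * d) := by
      have s1 := sq_sqrt p2.le
      have s2 := sq_sqrt p3.le
      have s3 := sq_sqrt pc.le
      have s4 := sq_sqrt pd.le
      have e2 : h₂ * d + h₃ * c - 2 * (√h₂ * √h₃) * (√d * √c) = (√h₂ * √d - √h₃ * √c) ^ 2 := by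
        rw [sub_sq, mul_pow, mul_pow, s1, s2, s3, s4]; ring
      have e3 : h₁ * (√c * √d) * (√d * √c) = h₁ * (c * d) := by
        rw [← s3, ← s4]; simp only [sqrt_sq qc.le, sqrt_sq qd.le]; ring
      nlinarith [sq_nonneg (√h₂ * √d - √h₃ * √c)]
    nlinarith [mul_le_mul_of_nonneg_right key (mul_pos q2 q3).le]
  · have cn : Continuous fun x : ℝ × ℝ => 1 + h₂ * x.2 + h₃ * x.1 - h₁ * (x.1 * x.2) := by
      fun_prop
    have cd : Continuous fun x : ℝ × ℝ => √(1 + e₃ * x.2 ^ 2 + 2 * (h₂ * x.2)) *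
        √(1 + e₂ * x.1 ^ 2 + 2 * (h₃ * x.1)) := by fun_prop
    have tn := (cn.tendsto (0, 0)).comp (tc.prodMk_nhds td)
    have td := (cd.tendsto (0, 0)).comp (tc.prodMk_nhds td)
    have t := (continuous_arccos.tendsto _).comp (tn.div td (by simp))
    have z : arccos ((1 + h₂ * 0 + h₃ * 0 - h₁ * (0 * 0)) /
        (√(1 + e₃ * 0 ^ 2 + 2 * (h₂ * 0)) * √(1 + e₂ * 0 ^ 2 + 2 * (h₃ * 0)))) = 0 := by simp
    exact z ▸ t

end Asymptotics

/-- A continuous function which is locally nonincreasing off the preimage of a finite set is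
antitone. -/
lemma antitone_of_deriv_nonpos_off_finite {g : ℝ → ℝ} (hg : Continuous g) {Z : Set ℝ}
    (hZ : Z.Finite) (h : ∀ s, g s ∈ Z ∨ ∃ g' ≤ 0, HasDerivAt g g' s) : Antitone g := by
  intro a b hab
  by_contra! hlt
  obtain ⟨y, hy, hyZ⟩ := (Set.Ioo_infinite hlt).exists_notMem_finite hZ
  obtain ⟨ε, hε, hball⟩ := Metric.isOpen_iff.1 hZ.isClosed.isOpen_compl y hyZ
  obtain ⟨z, hz1, hz2⟩ := exists_between (lt_min hy.2 (show y < y + ε by linarith))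
  have hz := lt_min_iff.1 hz2
  have hab' : a < b := lt_of_le_of_ne hab (by rintro rfl; exact lt_irrefl _ hlt)
  have hp : 0 < b - a := sub_pos.2 hab'
  set B : ℝ → ℝ := fun t => y + (z - y) * ((t - a) / (b - a)) with hB
  have hk : 0 < (z - y) / (b - a) := div_pos (sub_pos.2 hz1) hp
  have hBd (t : ℝ) : HasDerivAt B ((z - y) / (b - a)) t := by
    have := ((((hasDerivAt_id t).sub_const a).div_const (b - a)).const_mul (z - y)).const_add y
    exact this.congr_deriv (by ring)
  have hBc : Continuous B := continuous_iff_continuousAt.2 fun t => (hBd t).continuousAt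
  have hclosed : IsClosed ({t | g t ≤ B t} ∩ Set.Icc a b) :=
    (isClosed_le hg hBc).inter isClosed_Icc
  have key := hclosed.Icc_subset_of_forall_mem_nhdsWithin
    (by simp only [Set.mem_ofPred_eq, hB, sub_self, zero_div, mul_zero, add_zero]; exact hy.1.le)
    (fun t ht => by
      obtain ⟨htB, hta, htb⟩ := ht
      rcases lt_or_eq_of_le (show g t ≤ B t from htB) with hl | he
      · have hn : {s | g s < B s} ∈ 𝓝 t := (isOpen_lt hg hBc).mem_nhds hl
        filter_upwards [mem_nhdsWithin_of_mem_nhds hn] with s hs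
        exact le_of_lt hs
      · have hfrac0 : 0 ≤ (t - a) / (b - a) := div_nonneg (by linarith) hp.le
        have hfrac1 : (t - a) / (b - a) ≤ 1 := (div_le_one hp).2 (by linarith)
        have hnot : g t ∉ Z := by
          refine hball ?_
          rw [he, Metric.mem_ball, Real.dist_eq, abs_of_nonneg] <;> simp only [hB]
          · nlinarith
          · nlinarith
        obtain ⟨g', hg', hd⟩ := (h t).resolve_left hnot
        have hd2 := (hd.sub (hBd t)).hasDerivWithinAt (s := Set.Ioi t)
        have := (hasDerivWithinAt_iff_tendsto_slope' (by simp)).1 hd2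
        have ev := this.eventually (gt_mem_nhds (show g' - (z - y) / (b - a) < 0 by linarith))
        filter_upwards [ev, self_mem_nhdsWithin] with s hs hts
        have hts' : 0 < s - t := sub_pos.2 hts
        rw [slope_def_field] at hs
        have := (div_neg_iff.1 hs).resolve_left (fun h => absurd h.2 (not_lt.2 hts'.le))
        simp only [Pi.sub_apply, he, sub_self, sub_zero] at this
        exact sub_nonpos.1 (by linarith [this.1]))
  have := key (Set.right_mem_Icc.2 hab)
  simp only [Set.mem_ofPred_eq, hB, div_self hp.ne'] at this
  linarith [hz.1]

namespace TriSurface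

section Network

variable {N : ℕ} {S : TriSurface N}

/-- The extended angle of a face at its vertex `i`, in terms of the weights. -/
noncomputable def angle (W : Weights S) (u : Fin N → ℝ) (i j k : Fin N) : ℝ :=
  confAngle (W.eps i) (W.eps j) (W.eps k) (W.eta j k) (W.eta k i) (W.eta i j) (u i) (u j) (u k)

/-- The vertices of a face, listed in some order. -/
structure IsFace (S : TriSurface N) (i j k : Fin N) : Prop where
  mem : ({i, j, k} : Finset (Fin N)) ∈ S.F
  ne₁₂ : i ≠ j
  ne₁₃ : i ≠ k
  ne₂₃ : j ≠ k

lemma IsFace.rotate {i j k : Fin N} (h : S.IsFace i j k) : S.IsFace j k i := by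
  refine ⟨?_, h.ne₂₃, h.ne₁₂.symm, h.ne₁₃.symm⟩
  have : ({j, k, i} : Finset (Fin N)) = {i, j, k} := by ext; simp; tauto
  exact this ▸ h.mem

lemma IsFace.swap {i j k : Fin N} (h : S.IsFace i j k) : S.IsFace i k j := by
  refine ⟨?_, h.ne₁₃, h.ne₁₂, h.ne₂₃.symm⟩
  have : ({i, k, j} : Finset (Fin N)) = {i, j, k} := by ext; simp; tauto
  exact this ▸ h.mem

lemma exists_isFace {σ : Finset (Fin N)} (hσ : σ ∈ S.F) :
    ∃ i j k, S.IsFace i j k ∧ σ = {i, j, k} := by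
  obtain ⟨i, j, k, h1, h2, h3, rfl⟩ := Finset.card_eq_three.1 (S.card_face σ hσ)
  exact ⟨i, j, k, ⟨hσ, h1, h2, h3⟩, rfl⟩

variable (W : Weights S)

lemma IsFace.mem_edges {i j k : Fin N} (h : S.IsFace i j k) :
    ({i, j} : Finset (Fin N)) ∈ S.edges := by
  refine Finset.mem_biUnion.2 ⟨_, h.mem, Finset.mem_powersetCard.2 ⟨?_, Finset.card_pair h.ne₁₂⟩⟩
  intro x; simp; tauto

lemma IsFace.triWeights {i j k : Fin N} (h : S.IsFace i j k) :
    TriWeights (W.eps i) (W.eps j) (W.eps k) (W.eta j k) (W.eta k i) (W.eta i j) := by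
  have c1 := W.structCond2 i j k h.mem h.ne₁₂ h.ne₁₃ h.ne₂₃
  have c2 := W.structCond2 j k i h.rotate.mem h.ne₂₃ h.ne₁₂.symm h.ne₁₃.symm
  have c3 := W.structCond2 k i j h.rotate.rotate.mem h.ne₁₃.symm h.ne₂₃.symm h.ne₁₂
  rw [W.eta_symm i k] at c1
  rw [W.eta_symm j i] at c2
  rw [W.eta_symm k j] at c3
  exact ⟨W.eps01 i, W.eps01 j, W.eps01 k, W.structCond1 j k h.rotate.mem_edges,
    W.structCond1 k i h.rotate.rotate.mem_edges, W.structCond1 i j h.mem_edges,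
    by linarith, by linarith, by linarith⟩

lemma angle_swap (u : Fin N → ℝ) (i j k : Fin N) : angle W u i k j = angle W u i j k := by
  unfold angle
  rw [← confAngle_swap, W.eta_symm k j, W.eta_symm j i, W.eta_symm i k]

lemma angle_sum {i j k : Fin N} (h : S.IsFace i j k) (u : Fin N → ℝ) :
    angle W u i j k + angle W u j k i + angle W u k i j = π :=
  confAngle_sum (h.triWeights W) _ _ _

lemma sq_lE {i j k : Fin N} (h : S.IsFace i j k) (u : Fin N → ℝ) :
    0 < lE W u i j ∧ lE W u i j ^ 2 = W.eps i * exp (2 * u i) + W.eps j * exp (2 * u j) +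
      2 * (W.eta i j * exp (u i + u j)) := by
  have := ((h.triWeights W).triData (u i) (u j) (u k)).len₃
  unfold lE
  rw [mul_assoc 2]
  exact ⟨sqrt_pos.2 this, sq_sqrt this.le⟩

lemma lE_comm (u : Fin N → ℝ) (i j : Fin N) : lE W u j i = lE W u i j := by
  unfold lE
  rw [W.eta_symm j i, add_comm (u j), add_comm (W.eps j * _)]

lemma thetaE_eq_angle {i j k : Fin N} (h : S.IsFace i j k) (u : Fin N → ℝ) :
    thetaE W u i j k = angle W u i j k := by
  obtain ⟨p1, q1⟩ := sq_lE W h u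
  obtain ⟨p2, q2⟩ := sq_lE W h.rotate u
  obtain ⟨p3, q3⟩ := sq_lE W h.rotate.rotate u
  rw [lE_comm] at p3 q3
  unfold thetaE angle confAngle triAngle
  rw [q1, q2, q3]
  rw [← q1, add_comm (W.eps i * _) (W.eps k * _), ← q3, sqrt_sq p1.le, sqrt_sq p3.le]
  congr 1
  have := p1.ne'
  have := p3.ne'
  field_simp
  rw [q1, q3]
  ring

lemma thetaExE_eq_angle {i j k : Fin N} (h : S.IsFace i j k) (u : Fin N → ℝ) :
    thetaExE W u i j k = angle W u i j k := by
  rw [← thetaE_eq_angle W h]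
  have p1 := (sq_lE W h u).1
  have p2 := (sq_lE W h.rotate u).1
  have p3 := (sq_lE W h.rotate.rotate u).1
  rw [lE_comm] at p3
  unfold thetaExE
  split_ifs with c1 c2
  · rfl
  · refine (arccos_of_le_neg_one ?_).symm
    rw [div_le_iff₀ (by positivity)]
    nlinarith
  · refine (arccos_of_one_le ?_).symm
    rw [le_div_iff₀ (by positivity)]
    have : lE W u i k ≥ lE W u i j + lE W u j k ∨ lE W u i j ≥ lE W u i k + lE W u j k := by
      by_contra! hc
      exact c1 ⟨by linarith, by linarith, by linarith⟩
    rcases this with hc | hc <;> nlinarith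

lemma sum_erase_pair {i j k : Fin N} (h : S.IsFace i j k) (g : Fin N → Fin N → ℝ) :
    ∑ a ∈ ({i, j, k} : Finset (Fin N)).erase i,
      ∑ b ∈ (({i, j, k} : Finset (Fin N)).erase i).erase a, g a b = g j k + g k j := by
  have e1 : ({i, j, k} : Finset (Fin N)).erase i = {j, k} :=
    Finset.erase_insert (by simp [h.ne₁₂, h.ne₁₃])
  have e2 : ({j, k} : Finset (Fin N)).erase j = {k} := Finset.erase_insert (by simp [h.ne₂₃])
  have e3 : ({j, k} : Finset (Fin N)).erase k = {j} := by
    rw [Finset.pair_comm]; exact Finset.erase_insert (by simp [h.ne₂₃.symm])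
  rw [e1, Finset.sum_pair h.ne₂₃, e2, e3, Finset.sum_singleton, Finset.sum_singleton]

lemma faceAngleExE_eq {i j k : Fin N} (h : S.IsFace i j k) (u : Fin N → ℝ) :
    faceAngleExE W u i {i, j, k} = angle W u i j k := by
  unfold faceAngleExE
  rw [sum_erase_pair h, thetaExE_eq_angle W h, thetaExE_eq_angle W h.swap, angle_swap]
  ring

lemma faceAngleE_eq {i j k : Fin N} (h : S.IsFace i j k) (u : Fin N → ℝ) :
    faceAngleE W u i {i, j, k} = angle W u i j k := by
  unfold faceAngleE
  rw [sum_erase_pair h, thetaE_eq_angle W h, thetaE_eq_angle W h.swap, angle_swap]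
  ring

lemma exists_isFace_of_mem {σ : Finset (Fin N)} (hσ : σ ∈ S.F) {i : Fin N} (hi : i ∈ σ) :
    ∃ j k, S.IsFace i j k ∧ σ = {i, j, k} := by
  obtain ⟨a, b, c, h, rfl⟩ := exists_isFace hσ
  simp only [Finset.mem_insert, Finset.mem_singleton] at hi
  rcases hi with rfl | rfl | rfl
  · exact ⟨b, c, h, rfl⟩
  · exact ⟨c, a, h.rotate, by ext; simp; tauto⟩
  · exact ⟨a, b, h.rotate.rotate, by ext; simp; tauto⟩

/-- The extended curvature agrees with the classical one, as the law of cosines already yields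
the extended angles. -/
lemma KE_eq_KExE (u : Fin N → ℝ) (i : Fin N) : KE W u i = KExE W u i := by
  unfold KE KExE
  congr 1
  refine Finset.sum_congr rfl fun σ hσ => ?_
  obtain ⟨hσ, hi⟩ := Finset.mem_filter.1 hσ
  obtain ⟨j, k, h, rfl⟩ := exists_isFace_of_mem hσ hi
  rw [faceAngleE_eq W h, faceAngleExE_eq W h]

/-- The pairing of a weight function with the angles of a face. -/
noncomputable def facePairing (f u : Fin N → ℝ) (σ : Finset (Fin N)) : ℝ :=
  ∑ i ∈ σ, f i * faceAngleExE W u i σ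

lemma facePairing_eq (f u : Fin N → ℝ) {i j k : Fin N} (h : S.IsFace i j k) :
    facePairing W f u {i, j, k} =
      f i * angle W u i j k + f j * angle W u j k i + f k * angle W u k i j := by
  unfold facePairing
  rw [Finset.sum_insert (by simp [h.ne₁₂, h.ne₁₃]), Finset.sum_pair h.ne₂₃,
    faceAngleExE_eq W h]
  have e2 : ({i, j, k} : Finset (Fin N)) = {j, k, i} := by ext; simp; tauto
  have e3 : ({i, j, k} : Finset (Fin N)) = {k, i, j} := by ext; simp; tauto
  nth_rw 1 [e2]
  nth_rw 1 [e3]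
  rw [faceAngleExE_eq W h.rotate, faceAngleExE_eq W h.rotate.rotate]
  ring

lemma sum_mul_KExE (f u : Fin N → ℝ) :
    ∑ i, f i * KExE W u i = 2 * π * ∑ i, f i - ∑ σ ∈ S.F, facePairing W f u σ := by
  unfold KExE facePairing
  simp only [mul_sub, Finset.mul_sum, Finset.sum_sub_distrib]
  congr 1
  · exact Finset.sum_congr rfl fun _ _ => mul_comm _ _
  · exact Finset.sum_comm' fun i σ => by simp [and_comm]

lemma three_mul_card_faces : 3 * S.F.card = 2 * S.edges.card := by
  have h1 : ∑ σ ∈ S.F, ∑ e ∈ Finset.powersetCard 2 σ, 1 = 3 * S.F.card := by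
    rw [Finset.sum_congr rfl fun σ hσ => show _ = 3 by
      rw [Finset.sum_const, Finset.card_powersetCard, S.card_face σ hσ]; rfl]
    simp [mul_comm]
  have h2 : ∑ σ ∈ S.F, ∑ e ∈ Finset.powersetCard 2 σ, 1 =
      ∑ e ∈ S.edges, ∑ σ ∈ S.F.filter (fun σ => e ⊆ σ), 1 := by
    refine Finset.sum_comm' fun σ e => ?_
    simp only [edges, Finset.mem_biUnion, Finset.mem_powersetCard, Finset.mem_filter]
    constructor
    · rintro ⟨a, b, c⟩; exact ⟨⟨a, b⟩, σ, a, b, c⟩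
    · rintro ⟨⟨a, b⟩, _, _, _, c⟩; exact ⟨a, b, c⟩
  rw [← h1, h2, Finset.sum_congr rfl fun e he => show _ = 2 by
    obtain ⟨σ, hσ, he⟩ := Finset.mem_biUnion.1 he
    obtain ⟨he, hc⟩ := Finset.mem_powersetCard.1 he
    rw [Finset.sum_const, S.edge_two_faces e hc ⟨σ, hσ, he⟩]; rfl]
  simp [mul_comm]

/-- The discrete Gauss–Bonnet formula. -/
lemma sum_KExE (u : Fin N → ℝ) : ∑ i, KExE W u i = 2 * π * S.chi := by
  have h := sum_mul_KExE W (fun _ => 1) u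
  have hs : ∀ σ ∈ S.F, facePairing W (fun _ => 1) u σ = π := fun σ hσ => by
    obtain ⟨i, j, k, hf, rfl⟩ := exists_isFace hσ
    rw [facePairing_eq W _ _ hf, one_mul, one_mul, one_mul, angle_sum W hf]
  simp only [one_mul] at h
  rw [h, Finset.sum_congr rfl hs]
  have := three_mul_card_faces (S := S)
  have h3 : (3 : ℝ) * S.F.card = 2 * S.edges.card := by exact_mod_cast this
  unfold chi
  push_cast
  simp only [Finset.sum_const, Finset.card_univ, Fintype.card_fin, nsmul_eq_mul, mul_one]
  linear_combination (-π) * h3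

lemma continuous_angle {i j k : Fin N} (h : S.IsFace i j k) :
    Continuous fun u => angle W u i j k :=
  continuous_confAngle (h.triWeights W) (continuous_apply i) (continuous_apply j)
    (continuous_apply k)

lemma continuous_KExE : Continuous fun u => KExE W u := by
  refine continuous_pi fun i => continuous_const.sub (continuous_finsetSum _ fun σ hσ => ?_)
  obtain ⟨hσ, hi⟩ := Finset.mem_filter.1 hσ
  obtain ⟨j, k, h, rfl⟩ := exists_isFace_of_mem hσ hi
  simp only [faceAngleExE_eq W h]
  exact continuous_angle W h

lemma exists_abs_KExE_le : ∃ B, ∀ u i, |KExE W u i| ≤ B := by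
  refine ⟨2 * π + S.F.card * π, fun u i => ?_⟩
  have h0 : 0 ≤ ∑ σ ∈ S.F.filter (fun σ => i ∈ σ), faceAngleExE W u i σ ∧
      ∑ σ ∈ S.F.filter (fun σ => i ∈ σ), faceAngleExE W u i σ ≤ S.F.card * π := by
    have key : ∀ σ ∈ S.F.filter (fun σ => i ∈ σ), 0 ≤ faceAngleExE W u i σ ∧
        faceAngleExE W u i σ ≤ π := fun σ hσ => by
      obtain ⟨hσ, hi⟩ := Finset.mem_filter.1 hσ
      obtain ⟨j, k, h, rfl⟩ := exists_isFace_of_mem hσ hi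
      rw [faceAngleExE_eq W h]
      exact ⟨confAngle_nonneg .., confAngle_le_pi ..⟩
    refine ⟨Finset.sum_nonneg fun σ hσ => (key σ hσ).1, ?_⟩
    refine (Finset.sum_le_card_nsmul _ _ _ fun σ hσ => (key σ hσ).2).trans ?_
    rw [nsmul_eq_mul]
    gcongr
    exact Finset.filter_subset _ _
  have := pi_pos
  unfold KExE
  rw [abs_le]
  constructor <;> linarith [h0.1, h0.2]

end Network

end TriSurface

namespace TriSurface

section Monotone

variable {N : ℕ} {S : TriSurface N} (W : Weights S)

/-- The discriminant of a face. -/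
noncomputable def faceDisc (u : Fin N → ℝ) (i j k : Fin N) : ℝ :=
  triDisc (W.eps i * exp (2 * u i)) (W.eps j * exp (2 * u j)) (W.eps k * exp (2 * u k))
    (W.eta j k * exp (u j + u k)) (W.eta k i * exp (u k + u i)) (W.eta i j * exp (u i + u j))

lemma faceDisc_rotate (u : Fin N → ℝ) (i j k : Fin N) :
    faceDisc W u j k i = faceDisc W u i j k :=
  triDisc_rotate

lemma faceDisc_pos {u : Fin N → ℝ} (hu : admissibleE W u) {i j k : Fin N}
    (h : S.IsFace i j k) : 0 < faceDisc W u i j k := by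
  obtain ⟨p1, q1⟩ := sq_lE W h u
  obtain ⟨p2, q2⟩ := sq_lE W h.rotate u
  obtain ⟨p3, q3⟩ := sq_lE W h.rotate.rotate u
  have a1 := hu i j k h.mem
  have a2 := hu j k i h.rotate.mem
  have a3 := hu k i j h.rotate.rotate.mem
  rw [lE_comm W u k i] at a1
  rw [lE_comm W u i j] at a2
  rw [lE_comm W u j k] at a3
  have e : faceDisc W u i j k = lE W u k i ^ 2 * lE W u i j ^ 2 -
      ((lE W u i j ^ 2 + lE W u k i ^ 2 - lE W u j k ^ 2) / 2) ^ 2 := by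
    rw [q1, q2, q3]; unfold faceDisc triDisc; ring
  rw [e]
  set a := lE W u i j
  set b := lE W u j k
  set c := lE W u k i
  have : c ^ 2 * a ^ 2 - ((a ^ 2 + c ^ 2 - b ^ 2) / 2) ^ 2 =
    (b + a - c) * (b + c - a) * ((a + c - b) * (a + c + b)) / 4 := by ring
  rw [this]
  have := mul_pos (mul_pos (sub_pos.2 (show c < b + a by linarith))
    (sub_pos.2 (show a < b + c by linarith)))
    (mul_pos (sub_pos.2 (show b < a + c by linarith)) (show 0 < a + c + b by linarith))
  linarith

lemma angle_of_faceDisc_nonpos {i j k : Fin N} (h : S.IsFace i j k) {u : Fin N → ℝ}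
    (hD : faceDisc W u i j k ≤ 0) : ∃ b : Bool, angle W u i j k = if b then π else 0 := by
  rcases triAngle_of_disc_nonpos ((h.triWeights W).triData (u i) (u j) (u k)) hD with h | h
  · exact ⟨true, h.2⟩
  · exact ⟨false, h.2.trans (by simp)⟩

lemma facePairing_ray {i j k : Fin N} (h : S.IsFace i j k) (u d : Fin N → ℝ) {s : ℝ}
    (hD : 0 < faceDisc W (u + s • d) i j k) :
    ∃ g' ≤ 0, HasDerivAt (fun r : ℝ => facePairing W d (u + r • d) {i, j, k}) g' s ∧
      (g' = 0 → d i = d j ∧ d j = d k) := by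
  simp only [facePairing_eq W _ _ h]
  exact confAngle_ray (h.triWeights W) (u i) (u j) (u k) (d i) (d j) (d k) s hD

lemma antitone_facePairing {σ : Finset (Fin N)} (hσ : σ ∈ S.F) (u d : Fin N → ℝ) :
    Antitone fun r : ℝ => facePairing W d (u + r • d) σ := by
  obtain ⟨i, j, k, h, rfl⟩ := exists_isFace hσ
  refine antitone_of_deriv_nonpos_off_finite ?_ (Z := Set.range fun b : Bool × Bool × Bool =>
    d i * (if b.1 then π else 0) + d j * (if b.2.1 then π else 0) +
      d k * (if b.2.2 then π else 0)) (Set.finite_range _) fun s => ?_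
  · simp only [facePairing_eq W _ _ h]
    have hc : Continuous fun r : ℝ => u + r • d := by fun_prop
    have c1 := (continuous_angle W h).comp hc
    have c2 := (continuous_angle W h.rotate).comp hc
    have c3 := (continuous_angle W h.rotate.rotate).comp hc
    exact ((c1.const_mul _).add (c2.const_mul _)).add (c3.const_mul _)
  · rcases le_or_gt (faceDisc W (u + s • d) i j k) 0 with hD | hD
    · left
      obtain ⟨b1, e1⟩ := angle_of_faceDisc_nonpos W h hD
      obtain ⟨b2, e2⟩ := angle_of_faceDisc_nonpos W h.rotate ((faceDisc_rotate ..).trans_le hD)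
      obtain ⟨b3, e3⟩ := angle_of_faceDisc_nonpos W h.rotate.rotate
        (((faceDisc_rotate ..).trans (faceDisc_rotate ..)).trans_le hD)
      exact ⟨(b1, b2, b3), by simp only [facePairing_eq W _ _ h, e1, e2, e3]⟩
    · right
      obtain ⟨g', h1, h2, -⟩ := facePairing_ray W h u d hD
      exact ⟨g', h1, h2⟩

/-- The extended curvature is monotone along rays. -/
lemma monotone_KExE_ray (u d : Fin N → ℝ) :
    Monotone fun r : ℝ => ∑ i, d i * KExE W (u + r • d) i := by
  intro r s hrs
  simp only [sum_mul_KExE]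
  exact sub_le_sub_left (Finset.sum_le_sum fun σ hσ => antitone_facePairing W hσ u d hrs) _

lemma eq_of_forall_isFace {d : Fin N → ℝ}
    (h : ∀ i j k, S.IsFace i j k → d i = d j ∧ d j = d k) (a b : Fin N) : d a = d b := by
  obtain ⟨p⟩ := S.connected.preconnected a b
  induction p with
  | nil => rfl
  | cons hadj _ ih =>
    refine Eq.trans ?_ ih
    have key : ∀ {x y : Fin N} {σ}, σ ∈ S.F → x ∈ σ → y ∈ σ → d x = d y := by
      intro x y σ hσ hx hy
      obtain ⟨i, j, k, hf, rfl⟩ := exists_isFace hσ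
      have := h i j k hf
      simp only [Finset.mem_insert, Finset.mem_singleton] at hx hy
      rcases hx with rfl | rfl | rfl <;> rcases hy with rfl | rfl | rfl <;> linarith [this.1, this.2]
    rw [SimpleGraph.fromRel_adj] at hadj
    rcases hadj.2 with ⟨σ, hσ, hx, hy⟩ | ⟨σ, hσ, hx, hy⟩
    · exact key hσ hx hy
    · exact key hσ hy hx

lemma differentiableAt_KExE {u : Fin N → ℝ} (hu : admissibleE W u) :
    DifferentiableAt ℝ (fun v => KExE W v) u := by
  refine differentiableAt_pi.2 fun i => ?_
  refine DifferentiableAt.const_sub (DifferentiableAt.fun_sum fun σ hσ => ?_) _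
  obtain ⟨hσ, hi⟩ := Finset.mem_filter.1 hσ
  obtain ⟨j, k, h, rfl⟩ := exists_isFace_of_mem hσ hi
  simp only [faceAngleExE_eq W h]
  exact differentiableAt_confAngle (h.triWeights W) (differentiableAt_apply i u)
    (differentiableAt_apply j u) (differentiableAt_apply k u) (faceDisc_pos W hu h)

lemma fderiv_KExE_pos {u : Fin N → ℝ} (hu : admissibleE W u) {d : Fin N → ℝ}
    (hd : ∃ a b, d a ≠ d b) : 0 < ∑ i, d i * fderiv ℝ (fun v => KExE W v) u d i := by
  have hray : HasDerivAt (fun r : ℝ => KExE W (u + r • d)) (fderiv ℝ (fun v => KExE W v) u d) 0 := by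
    have h1 := (differentiableAt_KExE W hu).hasFDerivAt
    have h2 : HasDerivAt (fun r : ℝ => u + r • d) d 0 := by
      simpa using ((hasDerivAt_id (0 : ℝ)).smul_const d).const_add u
    rw [show u = u + (0 : ℝ) • d by simp] at h1
    have h3 := h1.comp_hasDerivAt 0 h2
    rwa [zero_smul, add_zero] at h3
  have hP : HasDerivAt (fun r : ℝ => ∑ i, d i * KExE W (u + r • d) i)
      (∑ i, d i * fderiv ℝ (fun v => KExE W v) u d i) 0 :=
    HasDerivAt.fun_sum fun i _ => ((hasDerivAt_pi.1 hray) i).const_mul (d i)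
  have hface : ∀ σ ∈ S.F, ∃ g' ≤ 0, HasDerivAt (fun r : ℝ => facePairing W d (u + r • d) σ) g' 0 ∧
      (g' = 0 → ∀ i j k, S.IsFace i j k → σ = {i, j, k} → d i = d j ∧ d j = d k) := by
    intro σ hσ
    obtain ⟨i, j, k, h, rfl⟩ := exists_isFace hσ
    obtain ⟨g', h1, h2, h3⟩ := facePairing_ray W h u d (s := 0)
      (by simpa using faceDisc_pos W hu h)
    refine ⟨g', h1, h2, fun h0 a b c h' e => ?_⟩
    have key : ∀ x ∈ ({i, j, k} : Finset (Fin N)), d x = d j := by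
      intro x hx
      simp only [Finset.mem_insert, Finset.mem_singleton] at hx
      rcases hx with rfl | rfl | rfl <;> linarith [(h3 h0).1, (h3 h0).2]
    rw [e] at key
    exact ⟨(key a (by simp)).trans (key b (by simp)).symm,
      (key b (by simp)).trans (key c (by simp)).symm⟩
  choose! g hg0 hgd hgz using hface
  have hQ : HasDerivAt (fun r : ℝ => ∑ i, d i * KExE W (u + r • d) i) (-∑ σ ∈ S.F, g σ) 0 := by
    simp only [sum_mul_KExE]
    exact (HasDerivAt.fun_sum fun σ hσ => hgd σ hσ).const_sub _
  rw [hP.unique hQ, neg_pos]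
  refine lt_of_le_of_ne (Finset.sum_nonpos hg0) fun h0 => ?_
  have hz := (Finset.sum_eq_zero_iff_of_nonpos hg0).1 h0
  obtain ⟨a, b, hab⟩ := hd
  exact hab (eq_of_forall_isFace (fun i j k h => hgz _ h.mem (hz _ h.mem) i j k h rfl) a b)

/-- Vectors having both nonpositive and nonnegative entries. -/
def mixedSign (N : ℕ) : Set (Fin N → ℝ) := {d | (∃ i, d i ≤ 0) ∧ ∃ j, 0 ≤ d j}

lemma isClosed_mixedSign (N : ℕ) : IsClosed (mixedSign N) := by
  have : mixedSign N = (⋃ i, {d | d i ≤ 0}) ∩ ⋃ j, {d | 0 ≤ d j} := by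
    ext d; simp [mixedSign]
  rw [this]
  exact (isClosed_iUnion_of_finite fun i => isClosed_le (continuous_apply i) continuous_const).inter
    (isClosed_iUnion_of_finite fun i => isClosed_le continuous_const (continuous_apply i))

lemma smul_mem_mixedSign {d : Fin N → ℝ} (hd : d ∈ mixedSign N) {r : ℝ} (hr : 0 ≤ r) :
    r • d ∈ mixedSign N := by
  obtain ⟨⟨i, hi⟩, j, hj⟩ := hd
  exact ⟨⟨i, mul_nonpos_of_nonneg_of_nonpos hr hi⟩, j, mul_nonneg hr hj⟩

lemma norm_sq_le_sum_sq (d : Fin N → ℝ) : ‖d‖ ^ 2 ≤ ∑ i, d i ^ 2 := by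
  rw [← sq_sqrt (Finset.sum_nonneg fun i _ => sq_nonneg (d i))]
  refine pow_le_pow_left₀ (norm_nonneg _) ((pi_norm_le_iff_of_nonneg (sqrt_nonneg _)).2 fun i => ?_) 2
  rw [Real.norm_eq_abs, ← sqrt_sq_eq_abs]
  exact sqrt_le_sqrt (Finset.single_le_sum (f := fun i => d i ^ 2) (fun i _ => sq_nonneg _)
    (Finset.mem_univ i))

/-- At an admissible point the Jacobian of the curvature is coercive on vectors of mixed sign. -/
lemma exists_fderiv_coercive {u : Fin N → ℝ} (hu : admissibleE W u) :
    ∃ κ > 0, ∀ d ∈ mixedSign N,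
      κ * ∑ i, d i ^ 2 ≤ ∑ i, d i * fderiv ℝ (fun v => KExE W v) u d i := by
  have hc : IsCompact ({d : Fin N → ℝ | ∑ i, d i ^ 2 = 1} ∩ mixedSign N) := by
    refine (Metric.isCompact_of_isClosed_isBounded (isClosed_eq (by fun_prop) continuous_const)
      ?_).inter_right (isClosed_mixedSign N)
    refine (Metric.isBounded_closedBall (x := (0 : Fin N → ℝ)) (r := 1)).subset fun d hd => ?_
    have hd : ∑ i, d i ^ 2 = 1 := hd
    have := norm_sq_le_sum_sq d
    rw [mem_closedBall_zero_iff]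
    nlinarith [norm_nonneg d]
  obtain ⟨κ, hκ, h⟩ := hc.exists_forall_le' (a := 0)
    (f := fun d => ∑ i, d i * fderiv ℝ (fun v => KExE W v) u d i) (by
      have (i : Fin N) : Continuous fun d => fderiv ℝ (fun v => KExE W v) u d i :=
        (continuous_apply i).comp (ContinuousLinearMap.continuous _)
      fun_prop) (fun d hd => by
      obtain ⟨hd1, ⟨i, hi⟩, j, hj⟩ := hd
      refine fderiv_KExE_pos W hu ?_
      by_contra! hcon
      have hi0 : d i = 0 := le_antisymm hi (hcon j i ▸ hj)
      have hd1 : ∑ i, d i ^ 2 = 1 := hd1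
      rw [Finset.sum_eq_zero fun x _ => by rw [hcon x i, hi0]; norm_num] at hd1
      exact zero_ne_one hd1)
  refine ⟨κ, hκ, fun d hd => ?_⟩
  have hnn : 0 ≤ ∑ i, d i ^ 2 := Finset.sum_nonneg fun i _ => sq_nonneg (d i)
  rcases hnn.eq_or_lt with h0 | hpos
  · have hz : d = 0 := by
      funext i
      exact pow_eq_zero_iff (n := 2) (by norm_num) |>.1
        ((Finset.sum_eq_zero_iff_of_nonneg fun i _ => sq_nonneg (d i)).1 h0.symm i
          (Finset.mem_univ i))
    simp [hz]
  · set n := √(∑ i, d i ^ 2) with hn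
    have hnp : 0 < n := sqrt_pos.2 hpos
    have hn2 : n ^ 2 = ∑ i, d i ^ 2 := sq_sqrt hnn
    have := h (n⁻¹ • d) ⟨by
      simp only [Set.mem_ofPred_eq, Pi.smul_apply, smul_eq_mul, mul_pow, ← Finset.mul_sum]
      rw [← hn2]; field_simp, smul_mem_mixedSign hd (inv_pos.2 hnp).le⟩
    simp only [map_smul, Pi.smul_apply, smul_eq_mul] at this
    have e : ∑ i, n⁻¹ * d i * (n⁻¹ * fderiv ℝ (fun v => KExE W v) u d i) =
        (∑ i, d i * fderiv ℝ (fun v => KExE W v) u d i) / n ^ 2 := by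
      rw [Finset.sum_div]
      refine Finset.sum_congr rfl fun i _ => ?_
      field_simp
    rw [e, le_div_iff₀ (by positivity)] at this
    rwa [← hn2]

/-- Quantitative strict monotonicity of the extended curvature at an admissible point. -/
lemma exists_KExE_coercive {u : Fin N → ℝ} (hu : admissibleE W u) :
    ∃ κ > 0, ∀ d ∈ mixedSign N,
      κ * min (∑ i, d i ^ 2) 1 ≤ ∑ i, d i * (KExE W (u + d) i - KExE W u i) := by
  obtain ⟨κ, hκ, hco⟩ := exists_fderiv_coercive W hu
  have hF := (differentiableAt_KExE W hu).hasFDerivAt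
  have hε : 0 < κ / (2 * (N + 1)) := by positivity
  have hlo := hF.isLittleO.def hε
  rw [Metric.eventually_nhds_iff] at hlo
  obtain ⟨r, hr, hlo⟩ := hlo
  have small : ∀ d ∈ mixedSign N, ‖d‖ < r →
      κ / 2 * ∑ i, d i ^ 2 ≤ ∑ i, d i * (KExE W (u + d) i - KExE W u i) := by
    intro d hd hdr
    have h1 := hlo (y := u + d) (by simpa [dist_eq_norm] using hdr)
    rw [add_sub_cancel_left] at h1
    set E := KExE W (u + d) - KExE W u - fderiv ℝ (fun v => KExE W v) u d with hE
    have h2 : -(κ / 2 * ∑ i, d i ^ 2) ≤ ∑ i, d i * E i := by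
      have hb : ∀ i, -(κ / (2 * (N + 1)) * ∑ i, d i ^ 2) ≤ d i * E i := fun i => by
        have a1 := norm_le_pi_norm d i
        have a2 := (norm_le_pi_norm E i).trans h1
        have a3 : |d i * E i| ≤ ‖d‖ * (κ / (2 * (N + 1)) * ‖d‖) := by
          rw [abs_mul]; exact mul_le_mul a1 a2 (abs_nonneg _) (norm_nonneg _)
        have a4 := mul_le_mul_of_nonneg_left (norm_sq_le_sum_sq d) hε.le
        have a5 := neg_abs_le (d i * E i)
        nlinarith
      have := Finset.card_nsmul_le_sum Finset.univ (fun i => d i * E i) _ fun i _ => hb i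
      rw [Finset.card_univ, Fintype.card_fin, nsmul_eq_mul] at this
      refine le_trans ?_ this
      have hS : 0 ≤ ∑ i, d i ^ 2 := Finset.sum_nonneg fun i _ => sq_nonneg (d i)
      have : (N : ℝ) * (κ / (2 * (N + 1))) ≤ κ / 2 := by
        rw [← mul_div_assoc, div_le_div_iff₀ (by positivity) (by positivity)]
        nlinarith
      nlinarith [mul_le_mul_of_nonneg_right this hS]
    have h3 := hco d hd
    have h4 : ∑ i, d i * (KExE W (u + d) i - KExE W u i) =
        ∑ i, d i * fderiv ℝ (fun v => KExE W v) u d i + ∑ i, d i * E i := by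
      rw [← Finset.sum_add_distrib]
      refine Finset.sum_congr rfl fun i _ => ?_
      simp only [hE, Pi.sub_apply]; ring
    rw [h4]; linarith
  set ρ := min (r / 2) 1 with hρ
  have hρ0 : 0 < ρ := lt_min (by linarith) one_pos
  have hρr : ρ < r := (min_le_left _ _).trans_lt (by linarith)
  have hρ1 : ρ ≤ 1 := min_le_right _ _
  refine ⟨κ / 2 * ρ ^ 2, by positivity, fun d hd => ?_⟩
  have hnn : 0 ≤ ∑ i, d i ^ 2 := Finset.sum_nonneg fun i _ => sq_nonneg (d i)
  by_cases hdr : ‖d‖ < r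
  · refine le_trans ?_ (small d hd hdr)
    have : ρ ^ 2 * min (∑ i, d i ^ 2) 1 ≤ ∑ i, d i ^ 2 := by
      have h1 : ρ ^ 2 ≤ 1 := pow_le_one₀ hρ0.le hρ1
      have h2 := min_le_left (∑ i, d i ^ 2) 1
      have h3 : 0 ≤ min (∑ i, d i ^ 2) 1 := le_min hnn zero_le_one
      nlinarith
    nlinarith
  · push Not at hdr
    have hdp : 0 < ‖d‖ := hr.trans_le hdr
    set s := ρ / ‖d‖ with hs
    have hs0 : 0 < s := div_pos hρ0 hdp
    have hs1 : s ≤ 1 := (div_le_one hdp).2 (hρr.le.trans hdr)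
    have hsd : ‖s • d‖ = ρ := by
      rw [norm_smul, Real.norm_of_nonneg hs0.le, hs, div_mul_cancel₀ _ hdp.ne']
    have h1 := small (s • d) (smul_mem_mixedSign hd hs0.le) (hsd ▸ hρr)
    have h2 : ρ ^ 2 ≤ ∑ i, (s • d) i ^ 2 := hsd ▸ norm_sq_le_sum_sq (s • d)
    have h3 := monotone_KExE_ray W u d hs1
    simp only [one_smul] at h3
    have h4 : ∑ i, (s • d) i * (KExE W (u + s • d) i - KExE W u i) =
        s * ∑ i, d i * (KExE W (u + s • d) i - KExE W u i) := by
      rw [Finset.mul_sum]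
      exact Finset.sum_congr rfl fun i _ => by rw [Pi.smul_apply, smul_eq_mul, mul_assoc]
    have h5 : ∑ i, d i * (KExE W (u + s • d) i - KExE W u i) ≤
        ∑ i, d i * (KExE W (u + d) i - KExE W u i) := by
      simp only [mul_sub, Finset.sum_sub_distrib]
      linarith
    have h6 : 0 < κ / 2 * ρ ^ 2 := by positivity
    have h7 : κ / 2 * ρ ^ 2 ≤ s * ∑ i, d i * (KExE W (u + s • d) i - KExE W u i) := by
      rw [← h4]
      exact (mul_le_mul_of_nonneg_left h2 (by positivity)).trans h1
    have h8 : 0 ≤ ∑ i, d i * (KExE W (u + s • d) i - KExE W u i) := by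
      by_contra! hneg
      nlinarith
    have h9 := min_le_right (∑ i, d i ^ 2) 1
    nlinarith

end Monotone

end TriSurface

lemma antitoneOn_Ici_of_hasDerivWithinAt {f f' : ℝ → ℝ}
    (h : ∀ t, 0 ≤ t → HasDerivWithinAt f (f' t) (Set.Ici 0) t) (hf' : ∀ t, 0 ≤ t → f' t ≤ 0) :
    AntitoneOn f (Set.Ici 0) := by
  have hi : ∀ t ∈ interior (Set.Ici (0 : ℝ)), HasDerivAt f (f' t) t := fun t ht => by
    rw [interior_Ici] at ht
    exact (h t (le_of_lt ht)).hasDerivAt (Ici_mem_nhds ht)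
  refine antitoneOn_of_deriv_nonpos (convex_Ici 0) (fun t ht => (h t ht).continuousWithinAt)
    (fun t ht => (hi t ht).differentiableAt.differentiableWithinAt) fun t ht => ?_
  rw [(hi t ht).deriv]
  exact hf' t (interior_subset ht)

lemma eq_of_hasDerivWithinAt_Ici_zero {f : ℝ → ℝ}
    (h : ∀ t, 0 ≤ t → HasDerivWithinAt f 0 (Set.Ici 0) t) {t : ℝ} (ht : 0 ≤ t) : f t = f 0 := by
  refine le_antisymm ?_ ?_
  · exact antitoneOn_Ici_of_hasDerivWithinAt h (fun _ _ => le_rfl) Set.self_mem_Ici ht ht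
  · have h' : ∀ t, 0 ≤ t → HasDerivWithinAt (fun t => -f t) 0 (Set.Ici 0) t := fun t ht => by
      simpa using (h t ht).fun_neg
    have := antitoneOn_Ici_of_hasDerivWithinAt h' (fun _ _ => le_rfl) Set.self_mem_Ici ht ht
    linarith

lemma le_of_radial_deriv_nonneg {f f' : ℝ → ℝ} (hf : ∀ x, HasDerivAt f (f' x) x) {a x s : ℝ}
    (hs : s ∈ Set.Icc (0 : ℝ) 1)
    (h : ∀ t ∈ Set.Ioo (0 : ℝ) 1, 0 ≤ (x - a) * f' (a + t * (x - a))) :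
    f (a + s * (x - a)) ≤ f x := by
  have hd (t : ℝ) : HasDerivAt (fun t => f (a + t * (x - a)))
      ((x - a) * f' (a + t * (x - a))) t := by
    have h1 : HasDerivAt (fun t => a + t * (x - a)) (x - a) t := by
      simpa using ((hasDerivAt_id t).mul_const (x - a)).const_add a
    exact ((hf _).comp t h1).congr_deriv (mul_comm _ _)
  have hm : MonotoneOn (fun t => f (a + t * (x - a))) (Set.Icc 0 1) := by
    refine monotoneOn_of_deriv_nonneg (convex_Icc 0 1)
      (fun t _ => (hd t).continuousAt.continuousWithinAt)
      (fun t _ => (hd t).differentiableAt.differentiableWithinAt) fun t ht => ?_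
    rw [interior_Icc] at ht
    rw [(hd t).deriv]
    exact h t ht
  have := hm hs (Set.right_mem_Icc.2 zero_le_one) hs.2
  simpa using this

/-- The one-variable summand of the Lyapunov function of the flow. -/
lemma exists_lyapunov (α a : ℝ) : ∃ (φ : ℝ → ℝ) (m M : ℝ), 0 < m ∧ 0 < M ∧
    (∀ x, HasDerivAt φ ((x - a) * exp (α * x)) x) ∧ (∀ x, m * min ((x - a) ^ 2) 1 ≤ φ x) ∧
    ∀ x, (x - a) ^ 2 ≤ 1 → φ x ≤ M * (x - a) ^ 2 := by
  have hcont : Continuous fun x => (x - a) * exp (α * x) := by fun_prop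
  set φ : ℝ → ℝ := fun x => ∫ t in a..x, (t - a) * exp (α * t)
  have hφ (x : ℝ) : HasDerivAt φ ((x - a) * exp (α * x)) x :=
    (hcont.integral_hasStrictDerivAt a x).hasDerivAt
  have hφa : φ a = 0 := intervalIntegral.integral_same
  set m := exp (α * a - |α|) with hm
  set M := exp (α * a + |α|) with hM
  have hbd : ∀ y, |y - a| ≤ 1 → m ≤ exp (α * y) ∧ exp (α * y) ≤ M := fun y hy => by
    have h1 : |α * (y - a)| ≤ |α| := by
      rw [abs_mul]; exact mul_le_of_le_one_right (abs_nonneg _) hy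
    have h2 := abs_le.1 h1
    constructor <;> refine exp_le_exp.2 ?_ <;> linarith [h2.1, h2.2]
  have hin : ∀ x, |x - a| ≤ 1 → ∀ t ∈ Set.Ioo (0 : ℝ) 1, |a + t * (x - a) - a| ≤ 1 :=
    fun x hx t ht => by
      rw [add_sub_cancel_left, abs_mul, abs_of_pos ht.1]
      exact mul_le_one₀ ht.2.le (abs_nonneg _) hx
  have hq (x : ℝ) : HasDerivAt (fun x => (x - a) ^ 2 / 2) (x - a) x := by
    exact ((((hasDerivAt_id x).sub_const a).pow 2).div_const 2).congr_deriv (by simp)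
  have lower : ∀ x, |x - a| ≤ 1 → m / 2 * (x - a) ^ 2 ≤ φ x := fun x hx => by
    have := le_of_radial_deriv_nonneg (fun x => (hφ x).sub ((hq x).const_mul m)) (a := a) (x := x)
      (Set.left_mem_Icc.2 zero_le_one) fun t ht => by
        have := (hbd _ (hin x hx t ht)).1
        have e : (x - a) * ((a + t * (x - a) - a) * exp (α * (a + t * (x - a))) -
          m * (a + t * (x - a) - a)) =
          (x - a) ^ 2 * (t * (exp (α * (a + t * (x - a))) - m)) := by ring
        rw [e]
        exact mul_nonneg (sq_nonneg _) (mul_nonneg ht.1.le (sub_nonneg.2 this))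
    simp only [Pi.sub_apply, zero_mul, add_zero, sub_self, hφa] at this
    linarith
  have upper : ∀ x, |x - a| ≤ 1 → φ x ≤ M / 2 * (x - a) ^ 2 := fun x hx => by
    have := le_of_radial_deriv_nonneg (fun x => ((hq x).const_mul M).sub (hφ x)) (a := a) (x := x)
      (Set.left_mem_Icc.2 zero_le_one) fun t ht => by
        have := (hbd _ (hin x hx t ht)).2
        have e : (x - a) * (M * (a + t * (x - a) - a) -
          (a + t * (x - a) - a) * exp (α * (a + t * (x - a)))) =
          (x - a) ^ 2 * (t * (M - exp (α * (a + t * (x - a))))) := by ring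
        rw [e]
        exact mul_nonneg (sq_nonneg _) (mul_nonneg ht.1.le (sub_nonneg.2 this))
    simp only [Pi.sub_apply, zero_mul, add_zero, sub_self, hφa] at this
    linarith
  refine ⟨φ, m / 2, M / 2, half_pos (exp_pos _), half_pos (exp_pos _), hφ, fun x => ?_,
    fun x hx => upper x ((sq_le_one_iff_abs_le_one _).1 hx)⟩
  have hm0 : 0 < m := exp_pos _
  rcases le_or_gt |x - a| 1 with hx | hx
  · refine (mul_le_mul_of_nonneg_left (min_le_left _ _) (by positivity)).trans (lower x hx)
  · have hp : 0 < |x - a| := by linarith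
    have h1 := le_of_radial_deriv_nonneg hφ (a := a) (x := x) (s := |x - a|⁻¹)
      ⟨(inv_pos.2 hp).le, inv_le_one_of_one_le₀ hx.le⟩ fun t ht => by
        have e : (x - a) * ((a + t * (x - a) - a) * exp (α * (a + t * (x - a)))) =
          (x - a) ^ 2 * (t * exp (α * (a + t * (x - a)))) := by ring
        rw [e]
        exact mul_nonneg (sq_nonneg _) (mul_nonneg ht.1.le (exp_pos _).le)
    have h2 : |a + |x - a|⁻¹ * (x - a) - a| = 1 := by
      rw [add_sub_cancel_left, abs_mul, abs_inv, abs_abs, inv_mul_cancel₀ hp.ne']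
    have h3 := lower _ h2.le
    rw [← sq_abs, h2] at h3
    have h4 := min_le_right ((x - a) ^ 2) 1
    nlinarith

namespace TriSurface

section Lyapunov

variable {N : ℕ} {S : TriSurface N} (W : Weights S)

lemma nonempty_vertices (S : TriSurface N) : Nonempty (Fin N) := by
  obtain ⟨σ, hσ⟩ := S.F_nonempty
  obtain ⟨i, -⟩ := exists_isFace hσ
  exact ⟨i⟩

lemma mul_sub_mul_exp_sub_nonpos {α c : ℝ} (h : α * c ≤ 0) (x y : ℝ) :
    c * ((x - y) * (exp (α * x) - exp (α * y))) ≤ 0 := by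
  rcases lt_trichotomy α 0 with hα | rfl | hα
  · have hc : 0 ≤ c := nonneg_of_mul_nonpos_right h hα
    refine mul_nonpos_of_nonneg_of_nonpos hc ?_
    rcases le_total x y with hxy | hxy
    · exact mul_nonpos_of_nonpos_of_nonneg (sub_nonpos.2 hxy)
        (sub_nonneg.2 (exp_le_exp.2 (mul_le_mul_of_nonpos_left hxy hα.le)))
    · exact mul_nonpos_of_nonneg_of_nonpos (sub_nonneg.2 hxy)
        (sub_nonpos.2 (exp_le_exp.2 (mul_le_mul_of_nonpos_left hxy hα.le)))
  · simp
  · have hc : c ≤ 0 := nonpos_of_mul_nonpos_right h hα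
    refine mul_nonpos_of_nonpos_of_nonneg hc ?_
    rcases le_total x y with hxy | hxy
    · exact mul_nonneg_of_nonpos_of_nonpos (sub_nonpos.2 hxy)
        (sub_nonpos.2 (exp_le_exp.2 (mul_le_mul_of_nonneg_left hxy hα.le)))
    · exact mul_nonneg (sub_nonneg.2 hxy)
        (sub_nonneg.2 (exp_le_exp.2 (mul_le_mul_of_nonneg_left hxy hα.le)))

lemma expConvergesTo_of_mixedSign {α c : ℝ} {ubar : Fin N → ℝ} (hbar : admissibleE W ubar)
    (hc : ∀ i, KExE W ubar i = c * exp (α * ubar i)) (hαc : α * c ≤ 0) {u : ℝ → Fin N → ℝ}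
    (hu : ∀ t, 0 ≤ t → ∀ i, HasDerivWithinAt (fun s => u s i)
      (c - KExE W (u t) i * exp (-(α * u t i))) (Set.Ici 0) t)
    (hmix : ∀ t, 0 ≤ t → u t - ubar ∈ mixedSign N) : ExpConvergesTo u ubar := by
  have := S.nonempty_vertices
  choose φ m M hm hM hφ hlow hup using fun i => exists_lyapunov α (ubar i)
  obtain ⟨im, him⟩ := Finite.exists_min m
  obtain ⟨iM, hiM⟩ := Finite.exists_max M
  obtain ⟨κ, hκ, hco⟩ := exists_KExE_coercive W hbar
  have hφ0 (i : Fin N) (x : ℝ) : 0 ≤ φ i x :=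
    le_trans (mul_nonneg (hm i).le (le_min (sq_nonneg _) zero_le_one)) (hlow i x)
  set V : ℝ → ℝ := fun t => ∑ i, φ i (u t i) with hV
  set V' : ℝ → ℝ := fun t => ∑ i, (u t i - ubar i) * exp (α * u t i) *
    (c - KExE W (u t) i * exp (-(α * u t i))) with hV'
  have hVd : ∀ t, 0 ≤ t → HasDerivWithinAt V (V' t) (Set.Ici 0) t := fun t ht =>
    HasDerivWithinAt.fun_sum fun i _ => (hφ i (u t i)).comp_hasDerivWithinAt t (hu t ht i)
  have hV0 (t : ℝ) : 0 ≤ V t := Finset.sum_nonneg fun i _ => hφ0 i _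
  have hnn (t : ℝ) : 0 ≤ min (∑ i, (u t i - ubar i) ^ 2) 1 :=
    le_min (Finset.sum_nonneg fun i _ => sq_nonneg _) zero_le_one
  have hdis : ∀ t, 0 ≤ t → V' t ≤ -(κ * min (∑ i, (u t i - ubar i) ^ 2) 1) := fun t ht => by
    have h1 := hco _ (hmix t ht)
    simp only [add_sub_cancel, Pi.sub_apply] at h1
    have h2 : V' t = ∑ i, c * ((u t i - ubar i) * (exp (α * u t i) - exp (α * ubar i))) -
        ∑ i, (u t i - ubar i) * (KExE W (u t) i - KExE W ubar i) := by
      rw [← Finset.sum_sub_distrib]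
      refine Finset.sum_congr rfl fun i _ => ?_
      have : exp (α * u t i) * exp (-(α * u t i)) = 1 := by rw [← exp_add]; simp
      rw [hc i]
      linear_combination -(u t i - ubar i) * KExE W (u t) i * this
    have h3 : ∑ i, c * ((u t i - ubar i) * (exp (α * u t i) - exp (α * ubar i))) ≤ 0 :=
      Finset.sum_nonpos fun i _ => mul_sub_mul_exp_sub_nonpos hαc _ _
    linarith
  have hanti : AntitoneOn V (Set.Ici 0) := antitoneOn_Ici_of_hasDerivWithinAt hVd fun t ht =>
    (hdis t ht).trans (neg_nonpos.2 (mul_nonneg hκ.le (hnn t)))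
  have hVle : ∀ t, 0 ≤ t → V t ≤ (M iM + V 0) * min (∑ i, (u t i - ubar i) ^ 2) 1 :=
    fun t ht => by
      rcases le_or_gt (∑ i, (u t i - ubar i) ^ 2) 1 with h | h
      · rw [min_eq_left h]
        have h1 : V t ≤ M iM * ∑ i, (u t i - ubar i) ^ 2 := by
          rw [Finset.mul_sum]
          refine Finset.sum_le_sum fun i _ => ?_
          have h2 : (u t i - ubar i) ^ 2 ≤ 1 := le_trans (Finset.single_le_sum
            (f := fun i => (u t i - ubar i) ^ 2) (fun i _ => sq_nonneg _) (Finset.mem_univ i)) h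
          exact (hup i _ h2).trans (mul_le_mul_of_nonneg_right (hiM i) (sq_nonneg _))
        have h3 : 0 ≤ V 0 * ∑ i, (u t i - ubar i) ^ 2 :=
          mul_nonneg (hV0 0) (Finset.sum_nonneg fun i _ => sq_nonneg _)
        linarith
      · rw [min_eq_right h.le]
        have h1 : V t ≤ V 0 := hanti Set.self_mem_Ici ht ht
        linarith [hM iM]
  have hMV : 0 < M iM + V 0 := add_pos_of_pos_of_nonneg (hM iM) (hV0 0)
  set β := κ / (M iM + V 0) with hβ
  have hβ0 : 0 < β := div_pos hκ hMV
  have hdec : ∀ t, 0 ≤ t → V t ≤ V 0 * exp (-(β * t)) := fun t ht => by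
    have hd : ∀ t, 0 ≤ t → HasDerivWithinAt (fun t => V t * exp (β * t))
        (V' t * exp (β * t) + V t * (exp (β * t) * β)) (Set.Ici 0) t := fun t ht => by
      have h1 : HasDerivAt (fun t => exp (β * t)) (exp (β * t) * β) t := by
        simpa using ((hasDerivAt_id t).const_mul β).exp
      exact (hVd t ht).mul h1.hasDerivWithinAt
    have := antitoneOn_Ici_of_hasDerivWithinAt hd (fun t ht => by
      have h1 : β * V t ≤ κ * min (∑ i, (u t i - ubar i) ^ 2) 1 := by
        refine (mul_le_mul_of_nonneg_left (hVle t ht) hβ0.le).trans_eq ?_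
        rw [← mul_assoc, hβ, div_mul_cancel₀ _ hMV.ne']
      have h2 : V' t * exp (β * t) + V t * (exp (β * t) * β) =
        (V' t + β * V t) * exp (β * t) := by ring
      rw [h2]
      exact mul_nonpos_of_nonpos_of_nonneg (by linarith [hdis t ht]) (exp_pos _).le)
      Set.self_mem_Ici ht ht
    simp only [mul_zero, exp_zero, mul_one] at this
    rw [exp_neg, ← div_eq_mul_inv, le_div_iff₀ (exp_pos _)]
    exact this
  have hlim : Tendsto (fun t => V 0 * exp (-(β * t))) atTop (𝓝 0) := by
    have : Tendsto (fun t => β * t) atTop atTop := tendsto_id.const_mul_atTop hβ0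
    simpa using (tendsto_exp_neg_atTop_nhds_zero.comp this).const_mul (V 0)
  obtain ⟨T, hT'⟩ := ((eventually_ge_atTop (0 : ℝ)).and
    (hlim.eventually (gt_mem_nhds (hm im)))).exists_forall_of_atTop
  have hT0 : 0 ≤ T := (hT' T le_rfl).1
  have hT : ∀ t, T ≤ t → V 0 * exp (-(β * t)) < m im := fun t ht => (hT' t ht).2
  have hcont : ContinuousOn (fun t => ∑ i, (u t i - ubar i) ^ 2) (Set.Icc 0 T) := fun t ht =>
    (HasDerivWithinAt.fun_sum fun i (_ : i ∈ Finset.univ) =>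
      ((hu t ht.1 i).sub_const (ubar i)).pow 2).continuousWithinAt.mono fun s hs => hs.1
  obtain ⟨B, hB⟩ := isCompact_Icc.exists_bound_of_continuousOn hcont
  set D := N * (V 0 / m im) + |B| * exp (β * T) + 1 with hD
  have hNV : 0 ≤ N * (V 0 / m im) := mul_nonneg N.cast_nonneg (div_nonneg (hV0 0) (hm im).le)
  have hBE : 0 ≤ |B| * exp (β * T) := mul_nonneg (abs_nonneg _) (exp_pos _).le
  have hD0 : 0 < D := by linarith
  have main : ∀ t, 0 ≤ t → ∑ i, (u t i - ubar i) ^ 2 ≤ D * exp (-(β * t)) := fun t ht => by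
    have he := exp_pos (-(β * t))
    rcases le_or_gt t T with htT | htT
    · have h1 := (le_abs_self _).trans (hB t ⟨ht, htT⟩)
      have h2 : |B| ≤ |B| * exp (β * T) * exp (-(β * t)) := by
        rw [mul_assoc, ← exp_add]
        refine le_mul_of_one_le_right (abs_nonneg _) (one_le_exp ?_)
        nlinarith
      have h3 : |B| * exp (β * T) * exp (-(β * t)) ≤ D * exp (-(β * t)) :=
        mul_le_mul_of_nonneg_right (by linarith) he.le
      linarith [le_abs_self B]
    · have h1 : ∀ i, (u t i - ubar i) ^ 2 ≤ V 0 / m im * exp (-(β * t)) := fun i => by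
        have a1 : m im * min ((u t i - ubar i) ^ 2) 1 ≤ V t :=
          ((mul_le_mul_of_nonneg_right (him i) (le_min (sq_nonneg _) zero_le_one)).trans
            (hlow i _)).trans (Finset.single_le_sum (f := fun i => φ i (u t i))
              (fun i _ => hφ0 i _) (Finset.mem_univ i))
        have a2 := a1.trans (hdec t ht)
        have a3 := hT t htT.le
        have a4 : min ((u t i - ubar i) ^ 2) 1 < 1 := by
          by_contra! hge
          nlinarith [hm im]
        have a5 : (u t i - ubar i) ^ 2 < 1 := (min_lt_iff.1 a4).resolve_right (lt_irrefl _)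
        rw [min_eq_left a5.le] at a2
        rw [div_mul_eq_mul_div, le_div_iff₀ (hm im)]
        linarith
      have h2 := Finset.sum_le_card_nsmul Finset.univ _ _ fun i _ => h1 i
      rw [Finset.card_univ, Fintype.card_fin, nsmul_eq_mul, ← mul_assoc] at h2
      exact h2.trans (mul_le_mul_of_nonneg_right (by linarith) he.le)
  refine ⟨√D, sqrt_pos.2 hD0, β / 2, half_pos hβ0, fun t ht => ?_⟩
  unfold TriSurface.enorm
  refine (sqrt_le_sqrt (main t ht)).trans_eq ?_
  rw [sqrt_mul hD0.le, ← exp_half]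
  congr 2
  ring

end Lyapunov

end TriSurface

namespace TriSurface

variable {N : ℕ} {S : TriSurface N}

section ConservedQuantities

lemma exists_KExE_eq_const_mul_exp (W : Weights S) {α : ℝ} {ubar : Fin N → ℝ}
    (hαχ : α * (S.chi : ℝ) ≤ 0) (hconst : ∃ c : ℝ, ∀ i, RE W α ubar i = c) :
    ∃ c : ℝ, (∀ i, KExE W ubar i = c * exp (α * ubar i)) ∧
      2 * π * S.chi = c * ∑ i, exp (α * ubar i) ∧ α * c ≤ 0 := by
  have := nonempty_vertices S
  obtain ⟨c, hc⟩ := hconst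
  have h : ∀ i, KExE W ubar i = c * exp (α * ubar i) := fun i => by
    rw [← hc i, RE, KE_eq_KExE, mul_assoc, ← exp_add, neg_add_cancel, exp_zero, mul_one]
  have hcA : 2 * π * S.chi = c * ∑ i, exp (α * ubar i) := by
    rw [← sum_KExE W ubar, Finset.sum_congr rfl fun i _ => h i, Finset.mul_sum]
  refine ⟨c, h, hcA, ?_⟩
  have hA : 0 < ∑ i, exp (α * ubar i) :=
    Finset.sum_pos (fun j _ => exp_pos _) Finset.univ_nonempty
  by_contra! hpos
  have := mul_pos hpos hA
  rw [mul_assoc, ← hcA] at this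
  nlinarith [pi_pos]

lemma exists_le_and_exists_ge_of_sum_eq {u v : Fin N → ℝ} (hN : Nonempty (Fin N))
    {φ : ℝ → ℝ} (hφ : StrictMono φ ∨ StrictAnti φ)
    (h : ∑ i, φ (u i) = ∑ i, φ (v i)) : u - v ∈ mixedSign N := by
  have hne : (Finset.univ : Finset (Fin N)).Nonempty := Finset.univ_nonempty
  by_contra hmem
  simp only [mixedSign, Set.mem_ofPred_eq, Pi.sub_apply, sub_nonpos, sub_nonneg, not_and_or,
    not_exists, not_le] at hmem
  rcases hmem with hmem | hmem <;> rcases hφ with hφ | hφ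
  · exact absurd h (Finset.sum_lt_sum_of_nonempty hne fun i _ => hφ (hmem i)).ne'
  · exact absurd h (Finset.sum_lt_sum_of_nonempty hne fun i _ => hφ (hmem i)).ne
  · exact absurd h (Finset.sum_lt_sum_of_nonempty hne fun i _ => hφ (hmem i)).ne
  · exact absurd h (Finset.sum_lt_sum_of_nonempty hne fun i _ => hφ (hmem i)).ne'

lemma strictMono_or_strictAnti_exp_mul {α : ℝ} (hα : α ≠ 0) :
    StrictMono (fun x => exp (α * x)) ∨ StrictAnti (fun x => exp (α * x)) := by
  rcases hα.lt_or_gt with h | h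
  · exact Or.inr fun x y hxy => exp_lt_exp.2 (mul_lt_mul_of_neg_left hxy h)
  · exact Or.inl fun x y hxy => exp_lt_exp.2 (mul_lt_mul_of_pos_left hxy h)

variable {W : Weights S} {α : ℝ} {u : ℝ → Fin N → ℝ}

lemma _root_.IsExtNormRicciSolE.sum_exp_eq (hu : IsExtNormRicciSolE W α u) {t : ℝ} (ht : 0 ≤ t) :
    ∑ i, exp (α * u t i) = ∑ i, exp (α * u 0 i) := by
  have := nonempty_vertices S
  refine eq_of_hasDerivWithinAt_Ici_zero (f := fun t => ∑ i, exp (α * u t i))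
    (fun t ht => ?_) ht
  have h := HasDerivWithinAt.fun_sum fun i (_ : i ∈ Finset.univ) =>
    ((hu t ht i).const_mul α).exp
  refine h.congr_deriv ?_
  have hpos : 0 < ∑ j, exp (α * u t j) :=
    Finset.sum_pos (fun j _ => exp_pos _) Finset.univ_nonempty
  have hterm : ∀ i, exp (α * u t i) * (α * (2 * π * S.chi / (∑ j, exp (α * u t j)) -
      RExE W α (u t) i)) = α * (2 * π * S.chi / (∑ j, exp (α * u t j)) * exp (α * u t i) -
        KExE W (u t) i) := fun i => by
    have := exp_ne_zero (α * u t i)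
    rw [RExE, exp_neg]
    field_simp
  rw [Finset.sum_congr rfl fun i _ => hterm i, ← Finset.mul_sum, Finset.sum_sub_distrib,
    ← Finset.mul_sum, sum_KExE, div_mul_cancel₀ _ hpos.ne', sub_self, mul_zero]

lemma _root_.IsExtNormRicciSolE.sum_eq (hu : IsExtNormRicciSolE W 0 u) {t : ℝ} (ht : 0 ≤ t) :
    ∑ i, u t i = ∑ i, u 0 i := by
  have := nonempty_vertices S
  refine eq_of_hasDerivWithinAt_Ici_zero (f := fun t => ∑ i, u t i) (fun t ht => ?_) ht
  have h := HasDerivWithinAt.fun_sum fun i (_ : i ∈ Finset.univ) => hu t ht i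
  refine h.congr_deriv ?_
  have hN : (N : ℝ) ≠ 0 := by
    have := Fin.pos_iff_nonempty.2 (nonempty_vertices S)
    positivity
  simp only [RExE, zero_mul, exp_zero, neg_zero, mul_one, Finset.sum_sub_distrib, sum_KExE,
    Finset.sum_const, Finset.card_univ, Fintype.card_fin, nsmul_eq_mul]
  field_simp
  ring

theorem _root_.IsExtNormRicciSolE.expConvergesTo (hu : IsExtNormRicciSolE W α u)
    (hαχ : α * (S.chi : ℝ) ≤ 0) {ubar : Fin N → ℝ} (hbar : admissibleE W ubar)
    (hconst : ∃ c : ℝ, ∀ i, RE W α ubar i = c)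
    (h1 : α ≠ 0 → ∑ i, exp (α * u 0 i) = ∑ i, exp (α * ubar i))
    (h2 : α = 0 → ∑ i, u 0 i = ∑ i, ubar i) : ExpConvergesTo u ubar := by
  have hN := nonempty_vertices S
  obtain ⟨c, hc, hcA, hαc⟩ := exists_KExE_eq_const_mul_exp W hαχ hconst
  have hA : 0 < ∑ i, exp (α * ubar i) :=
    Finset.sum_pos (fun j _ => exp_pos _) Finset.univ_nonempty
  have hsum : ∀ t, 0 ≤ t → ∑ i, exp (α * u t i) = ∑ i, exp (α * ubar i) := fun t ht => by
    by_cases hα : α = 0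
    · simp [hα]
    · rw [hu.sum_exp_eq ht, h1 hα]
  refine expConvergesTo_of_mixedSign W hbar hc hαc (fun t ht i => ?_) fun t ht => ?_
  · have := hu t ht i
    rwa [hsum t ht, hcA, mul_div_cancel_right₀ _ hA.ne'] at this
  · by_cases hα : α = 0
    · subst hα
      exact exists_le_and_exists_ge_of_sum_eq hN (φ := id) (Or.inl strictMono_id)
        (by simpa using (hu.sum_eq ht).trans (h2 rfl))
    · exact exists_le_and_exists_ge_of_sum_eq hN (strictMono_or_strictAnti_exp_mul hα) (hsum t ht)

end ConservedQuantities

end TriSurface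

section Peano

variable {E : Type*} [NormedAddCommGroup E] [NormedSpace ℝ E]

/-- The Euler polygon with step `h` for the autonomous field `f`, starting at `x`. -/
def eulerPolygon (f : E → E) (h : ℝ) (x : E) : ℕ → E
  | 0 => x
  | k + 1 => eulerPolygon f h x k + h • f (eulerPolygon f h x k)

lemma norm_eulerPolygon_sub_le {f : E → E} {h ω : ℝ} (hh : 0 ≤ h) {x y : E} {k l : ℕ}
    (hkl : k ≤ l) (hω : ∀ m, k ≤ m → m < l → ‖f (eulerPolygon f h x m) - y‖ ≤ ω) :
    ‖eulerPolygon f h x l - eulerPolygon f h x k - (((l : ℝ) - k) * h) • y‖ ≤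
      ((l : ℝ) - k) * h * ω := by
  induction l, hkl using Nat.le_induction with
  | base => simp
  | succ l hkl ih =>
    have h1 := ih fun m hm hml => hω m hm (hml.trans l.lt_succ_self)
    have h2 := mul_le_mul_of_nonneg_left (hω l hkl l.lt_succ_self) hh
    rw [← abs_of_nonneg hh, ← norm_eq_abs, ← norm_smul, norm_eq_abs, abs_of_nonneg hh] at h2
    have h3 : eulerPolygon f h x (l + 1) - eulerPolygon f h x k -
        ((((l + 1 : ℕ) : ℝ) - k) * h) • y =
        (eulerPolygon f h x l - eulerPolygon f h x k - (((l : ℝ) - k) * h) • y) +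
          h • (f (eulerPolygon f h x l) - y) := by
      rw [eulerPolygon]
      push_cast
      module
    rw [h3]
    refine (norm_add_le _ _).trans ((add_le_add h1 h2).trans_eq ?_)
    push_cast
    ring

/-- **Peano's existence theorem** for bounded continuous autonomous fields. -/
theorem exists_hasDerivWithinAt_Ici_of_continuous_of_bounded [ProperSpace E] {f : E → E}
    (hf : Continuous f) {K : ℝ} (hK : ∀ x, ‖f x‖ ≤ K) (x₀ : E) :
    ∃ u : ℝ → E, u 0 = x₀ ∧ ∀ t, 0 ≤ t → HasDerivWithinAt u (f (u t)) (Set.Ici 0) t := by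
  have hK0 : 0 ≤ K := (norm_nonneg _).trans (hK x₀)
  set h : ℕ → ℝ := fun n => ((n : ℝ) + 1)⁻¹ with hh
  have hpos : ∀ n, 0 < h n := fun n => by positivity
  have hlim : Tendsto h (hyperfilter ℕ) (𝓝 0) := by
    have := tendsto_one_div_add_atTop_nhds_zero_nat (𝕜 := ℝ)
    simp only [one_div] at this
    exact this.mono_left Nat.hyperfilter_le_atTop
  set e : ℕ → ℕ → E := fun n => eulerPolygon f (h n) x₀ with he
  set ix : ℕ → ℝ → ℕ := fun n t => ⌊t / h n⌋₊ with hix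
  have hix1 : ∀ n t, 0 ≤ t → ix n t * h n ≤ t := fun n t ht =>
    (le_div_iff₀ (hpos n)).1 (Nat.floor_le (div_nonneg ht (hpos n).le))
  have hix2 : ∀ n t, t < ix n t * h n + h n := fun n t => by
    have := (div_lt_iff₀ (hpos n)).1 (Nat.lt_floor_add_one (t / h n))
    rwa [add_mul, one_mul] at this
  have hixm : ∀ n, Monotone (ix n) := fun n s t hst =>
    Nat.floor_mono (div_le_div_of_nonneg_right hst (hpos n).le)
  have hLip : ∀ n k l, k ≤ l → ‖e n l - e n k‖ ≤ ((l : ℝ) - k) * h n * K := fun n k l hkl => by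
    simpa using norm_eulerPolygon_sub_le (y := 0) (hpos n).le hkl (x := x₀) (f := f)
      fun m _ _ => by simpa using hK _
  have hconv : ∀ t, ∃ x, 0 ≤ t → Tendsto (fun n => e n (ix n t)) (hyperfilter ℕ) (𝓝 x) := by
    intro t
    rcases lt_or_ge t 0 with ht | ht
    · exact ⟨x₀, fun h => absurd h ht.not_ge⟩
    have hmem : ∀ n, e n (ix n t) ∈ Metric.closedBall x₀ (t * K) := fun n => by
      rw [mem_closedBall_iff_norm]
      refine (hLip n 0 (ix n t) (Nat.zero_le _)).trans ?_
      rw [Nat.cast_zero, sub_zero]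
      exact mul_le_mul_of_nonneg_right (hix1 n t ht) hK0
    obtain ⟨x, -, hx⟩ := (isCompact_closedBall x₀ (t * K)).ultrafilter_le_nhds
      ((hyperfilter ℕ).map fun n => e n (ix n t))
      (by rw [le_principal_iff]; exact mem_map.2 (Eventually.of_forall hmem))
    exact ⟨x, fun _ => hx⟩
  choose u hu using hconv
  have hstep : ∀ t, 0 ≤ t → Tendsto (fun n => (ix n t : ℝ) * h n) (hyperfilter ℕ) (𝓝 t) :=
    fun t ht => by
      refine tendsto_of_tendsto_of_tendsto_of_le_of_le (g := fun n => t - h n)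
        (by simpa using hlim.const_sub t) tendsto_const_nhds (fun n => ?_) fun n => hix1 n t ht
      have := hix2 n t
      simp only
      linarith
  refine ⟨u, ?_, fun τ hτ => ?_⟩
  · refine tendsto_nhds_unique (hu 0 le_rfl) (tendsto_const_nhds.congr fun n => ?_)
    simp [hix, he, eulerPolygon]
  rw [hasDerivWithinAt_iff_isLittleO, Asymptotics.isLittleO_iff]
  intro ω hω
  obtain ⟨δ, hδ, hfδ⟩ := Metric.continuous_iff.1 hf (u τ) ω hω
  have key : ∀ s t, 0 ≤ s → s ≤ τ → τ ≤ t → (t - s) * K < δ →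
      ‖u t - u s - (t - s) • f (u τ)‖ ≤ (t - s) * ω := by
    intro s t hs hsτ hτt hst
    have ht := (hs.trans hsτ).trans hτt
    have l1 := (((hu t ht).sub (hu s hs)).sub
      (((hstep t ht).sub (hstep s hs)).smul_const (f (u τ)))).norm
    have l2 := ((hstep t ht).sub (hstep s hs)).mul_const ω
    refine le_of_tendsto_of_tendsto l1 l2 ?_
    have l3 : Tendsto (fun n => ‖e n (ix n τ) - u τ‖ + (t - s + h n) * K) (hyperfilter ℕ)
        (𝓝 (‖u τ - u τ‖ + (t - s + 0) * K)) :=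
      ((hu τ hτ).sub_const _).norm.add ((hlim.const_add _).mul_const K)
    rw [sub_self, norm_zero, zero_add, add_zero] at l3
    filter_upwards [l3.eventually (gt_mem_nhds hst)] with n hn
    rw [← sub_mul]
    refine norm_eulerPolygon_sub_le (hpos n).le (hixm n (hsτ.trans hτt)) fun m hm1 hm2 => ?_
    have hm : ‖e n m - e n (ix n τ)‖ ≤ (t - s + h n) * K := by
      have b1 : ((ix n t : ℝ) - ix n s) * h n ≤ t - s + h n := by
        have := hix1 n t ht
        have := hix2 n s
        rw [sub_mul]
        linarith
      refine le_trans ?_ (mul_le_mul_of_nonneg_right b1 hK0)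
      have c1 : (ix n s : ℝ) ≤ ix n τ := Nat.cast_le.2 (hixm n hsτ)
      have c2 : (ix n τ : ℝ) ≤ ix n t := Nat.cast_le.2 (hixm n hτt)
      have c3 : (ix n s : ℝ) ≤ m := Nat.cast_le.2 hm1
      have c4 : (m : ℝ) ≤ ix n t := Nat.cast_le.2 hm2.le
      rcases le_total m (ix n τ) with hmτ | hmτ
      · rw [norm_sub_rev]
        refine (hLip n _ _ hmτ).trans ?_
        have := (hpos n).le
        gcongr
      · refine (hLip n _ _ hmτ).trans ?_
        have := (hpos n).le
        gcongr
    rw [← dist_eq_norm]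
    refine (hfδ _ ?_).le
    rw [dist_eq_norm]
    calc ‖e n m - u τ‖ ≤ ‖e n m - e n (ix n τ)‖ + ‖e n (ix n τ) - u τ‖ :=
          norm_sub_le_norm_sub_add_norm_sub _ _ _
      _ < δ := by linarith
  have hnear : ∀ᶠ t in 𝓝[Set.Ici 0] τ, |t - τ| * K < δ := by
    have : Tendsto (fun t => |t - τ| * K) (𝓝[Set.Ici 0] τ) (𝓝 (|τ - τ| * K)) :=
      (Continuous.tendsto (by fun_prop) τ).mono_left nhdsWithin_le_nhds
    rw [sub_self, abs_zero, zero_mul] at this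
    exact this.eventually (gt_mem_nhds hδ)
  filter_upwards [hnear, self_mem_nhdsWithin] with t ht ht0
  rcases le_total τ t with hτt | hτt
  · rw [norm_eq_abs]
    rw [abs_of_nonneg (sub_nonneg.2 hτt)] at ht ⊢
    rw [mul_comm ω]
    exact key τ t hτ le_rfl hτt ht
  · rw [norm_eq_abs]
    rw [abs_of_nonpos (sub_nonpos.2 hτt), neg_sub] at ht ⊢
    have := key t τ ht0 hτt le_rfl ht
    rw [mul_comm ω]
    have hneg : u t - u τ - (t - τ) • f (u τ) = -(u τ - u t - (τ - t) • f (u τ)) := by module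
    rwa [hneg, norm_neg]

end Peano

namespace TriSurface

variable {N : ℕ} {S : TriSurface N}

section Degeneration

/-- The filter of conformal factors on which the vertices of `I` are infinitely far below all
other vertices. -/
def lowFilter (I : Finset (Fin N)) : Filter (Fin N → ℝ) :=
  ⨅ L : ℝ, 𝓟 {u | ∀ i ∈ I, ∀ j ∉ I, L ≤ u j - u i}

lemma mem_lowFilter {I : Finset (Fin N)} {s : Set (Fin N → ℝ)} :
    s ∈ lowFilter I ↔ ∃ L : ℝ, {u | ∀ i ∈ I, ∀ j ∉ I, L ≤ u j - u i} ⊆ s := by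
  unfold lowFilter
  rw [mem_iInf_of_directed]
  · simp only [mem_principal]
  · refine fun a b => ⟨max a b, ?_, ?_⟩
    · exact principal_mono.2 fun u hu i hi j hj => (le_max_left _ _).trans (hu i hi j hj)
    · exact principal_mono.2 fun u hu i hi j hj => (le_max_right _ _).trans (hu i hi j hj)

lemma tendsto_sub_lowFilter {I : Finset (Fin N)} {i j : Fin N} (hi : i ∈ I) (hj : j ∉ I) :
    Tendsto (fun u : Fin N → ℝ => u j - u i) (lowFilter I) atTop :=
  tendsto_atTop.2 fun L => mem_lowFilter.2 ⟨L, fun _ hu => hu i hi j hj⟩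

lemma tendsto_lowFilter {β : Type*} {l : Filter β} {I : Finset (Fin N)} {u : β → Fin N → ℝ}
    (h : ∀ i ∈ I, ∀ j ∉ I, Tendsto (fun b => u b j - u b i) l atTop) :
    Tendsto u l (lowFilter I) := by
  refine tendsto_iInf.2 fun L => tendsto_principal.2 ?_
  refine eventually_all.2 fun i => ?_
  by_cases hi : i ∈ I
  swap
  · exact Eventually.of_forall fun _ h => absurd h hi
  simp only [hi, forall_true_left]
  refine eventually_all.2 fun j => ?_
  by_cases hj : j ∈ I
  · exact Eventually.of_forall fun _ h => absurd hj h
  simpa only [hj, not_false_eq_true, forall_true_left] using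
    (h i hi j hj).eventually_ge_atTop L

variable (W : Weights S)

lemma exists_tendsto_facePairing {σ : Finset (Fin N)} (hσ : σ ∈ S.F) (I : Finset (Fin N)) :
    ∃ θ, Tendsto (fun u => facePairing W (fun i => if i ∈ I then 1 else 0) u σ)
      (lowFilter I) (𝓝 θ) := by
  have low : ∀ i j k, S.IsFace i j k → i ∈ I → j ∉ I → k ∉ I →
      ∃ θ, Tendsto (fun u => angle W u i j k) (lowFilter I) (𝓝 θ) := fun i j k h hi hj hk =>
    exists_tendsto_confAngle_low (h.triWeights W) (tendsto_sub_lowFilter hi hj)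
      (tendsto_sub_lowFilter hi hk)
  have high : ∀ i j k, S.IsFace i j k → i ∉ I → j ∈ I → k ∈ I →
      ∃ θ, Tendsto (fun u => angle W u j k i + angle W u k i j) (lowFilter I) (𝓝 θ) :=
    fun i j k h hi hj hk => by
      have := (tendsto_confAngle_high (h.triWeights W) (tendsto_sub_lowFilter hj hi)
        (tendsto_sub_lowFilter hk hi)).const_sub π
      refine ⟨π - 0, this.congr fun u => ?_⟩
      rw [← angle_sum W h u]
      simp only [angle]
      ring
  obtain ⟨i, j, k, h, rfl⟩ := exists_isFace hσ
  simp only [facePairing_eq W _ _ h]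
  by_cases hi : i ∈ I <;> by_cases hj : j ∈ I <;> by_cases hk : k ∈ I <;>
    simp only [hi, hj, hk, if_true, if_false, one_mul, zero_mul, add_zero, zero_add]
  · exact ⟨π, tendsto_const_nhds.congr fun u => (angle_sum W h u).symm⟩
  · exact high k i j h.rotate.rotate hk hi hj
  · obtain ⟨θ, hθ⟩ := high j k i h.rotate hj hk hi
    exact ⟨θ, hθ.congr fun u => add_comm _ _⟩
  · exact low i j k h hi hj hk
  · exact high i j k h hi hj hk
  · exact low j k i h.rotate hj hk hi
  · exact low k i j h.rotate.rotate hk hi hj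
  · exact ⟨0, tendsto_const_nhds⟩

lemma exists_tendsto_sum_KExE (I : Finset (Fin N)) :
    ∃ Λ, Tendsto (fun u => ∑ i ∈ I, KExE W u i) (lowFilter I) (𝓝 Λ) := by
  have h : ∀ u, ∑ i ∈ I, KExE W u i = 2 * π * ∑ i, (if i ∈ I then (1 : ℝ) else 0) -
      ∑ σ ∈ S.F, facePairing W (fun i => if i ∈ I then 1 else 0) u σ := fun u => by
    rw [← sum_mul_KExE]
    simp
  simp only [h]
  choose θ hθ using fun σ : S.F => exists_tendsto_facePairing W σ.2 I
  refine ⟨_, ((tendsto_finsetSum S.F.attach fun σ _ => hθ σ).const_sub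
    (2 * π * ∑ i, (if i ∈ I then (1 : ℝ) else 0))).congr fun u => ?_⟩
  rw [Finset.sum_attach S.F fun σ => facePairing W (fun i => if i ∈ I then 1 else 0) u σ]

lemma exists_pos_le_sum_mul_KExE {ubar : Fin N → ℝ} (hbar : admissibleE W ubar)
    {d : Fin N → ℝ} (hd : d ∈ mixedSign N) (hd1 : 1 ≤ ∑ i, d i ^ 2)
    (h0 : ∀ i, 0 ≤ d i * KExE W ubar i) :
    ∃ κ > 0, ∀ r : ℝ, 1 ≤ r → κ ≤ ∑ i, d i * KExE W (ubar + r • d) i := by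
  obtain ⟨κ, hκ, hco⟩ := exists_KExE_coercive W hbar
  refine ⟨κ, hκ, fun r hr => ?_⟩
  have h1 := hco d hd
  rw [min_eq_right hd1, mul_one] at h1
  have h2 := monotone_KExE_ray W ubar d hr
  simp only [one_smul, mul_sub, Finset.sum_sub_distrib] at h1 h2
  have h3 := Finset.sum_nonneg fun i (_ : i ∈ Finset.univ) => h0 i
  linarith

lemma exists_gap_sum_KExE_le {ubar : Fin N → ℝ} (hbar : admissibleE W ubar)
    (hK : ∀ i, KExE W ubar i ≤ 0) {I : Finset (Fin N)} (hI : I.Nonempty) (hI' : I ≠ Finset.univ) :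
    ∃ δ > 0, ∃ L, ∀ u : Fin N → ℝ, (∀ i ∈ I, ∀ j ∉ I, L ≤ u j - u i) →
      ∑ i ∈ I, KExE W u i ≤ -δ := by
  obtain ⟨i₀, hi₀⟩ := hI
  obtain ⟨j₀, hj₀⟩ : ∃ j, j ∉ I := by
    by_contra! h
    exact hI' (Finset.eq_univ_iff_forall.2 h)
  set d : Fin N → ℝ := fun i => if i ∈ I then -1 else 0 with hd
  have hd1 : 1 ≤ ∑ i, d i ^ 2 := by
    refine le_trans ?_ (Finset.single_le_sum (fun i _ => sq_nonneg (d i)) (Finset.mem_univ i₀))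
    simp [hd, hi₀]
  obtain ⟨κ, hκ, hr⟩ := exists_pos_le_sum_mul_KExE W hbar (d := d)
    ⟨⟨j₀, by simp [hd, hj₀]⟩, ⟨j₀, by simp [hd, hj₀]⟩⟩ hd1 fun i => by
      have := hK i
      by_cases hi : i ∈ I <;> simp [hd, hi, this]
  obtain ⟨Λ, hΛ⟩ := exists_tendsto_sum_KExE W I
  have hray : Tendsto (fun r : ℝ => ubar + r • d) atTop (lowFilter I) :=
    tendsto_lowFilter fun i hi j hj => by
      have : Tendsto (fun r : ℝ => (ubar j - ubar i) + r) atTop atTop :=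
        tendsto_atTop_add_const_left _ _ tendsto_id
      refine this.congr fun r => ?_
      simp [hd, hi, hj]
      ring
  have hΛκ : Λ ≤ -κ := by
    refine le_of_tendsto (hΛ.comp hray) ((eventually_ge_atTop 1).mono fun r h => ?_)
    have := hr r h
    simp only [hd, ite_mul, zero_mul, neg_mul, one_mul, Finset.sum_ite_mem, Finset.univ_inter,
      Finset.sum_neg_distrib] at this
    simp only [Function.comp_apply]
    linarith
  obtain ⟨L, hL⟩ := mem_lowFilter.1 (hΛ.eventually (gt_mem_nhds (show Λ < -(κ / 2) by linarith)))
  exact ⟨κ / 2, half_pos hκ, L, fun u hu => (hL hu).le⟩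

lemma exists_gap_le_sum_KExE {ubar : Fin N → ℝ} (hbar : admissibleE W ubar)
    (hK : ∀ i, 0 ≤ KExE W ubar i) {I : Finset (Fin N)} (hI : I.Nonempty) (hI' : I ≠ Finset.univ) :
    ∃ δ > 0, ∃ L, ∀ u : Fin N → ℝ, (∀ i ∈ I, ∀ j ∉ I, L ≤ u i - u j) →
      δ ≤ ∑ i ∈ I, KExE W u i := by
  obtain ⟨i₀, hi₀⟩ := hI
  obtain ⟨j₀, hj₀⟩ : ∃ j, j ∉ I := by
    by_contra! h
    exact hI' (Finset.eq_univ_iff_forall.2 h)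
  set d : Fin N → ℝ := fun i => if i ∈ I then 1 else 0 with hd
  have hd1 : 1 ≤ ∑ i, d i ^ 2 := by
    refine le_trans ?_ (Finset.single_le_sum (fun i _ => sq_nonneg (d i)) (Finset.mem_univ i₀))
    simp [hd, hi₀]
  obtain ⟨κ, hκ, hr⟩ := exists_pos_le_sum_mul_KExE W hbar (d := d)
    ⟨⟨j₀, by simp [hd, hj₀]⟩, ⟨j₀, by simp [hd, hj₀]⟩⟩ hd1 fun i => by
      have := hK i
      by_cases hi : i ∈ I <;> simp [hd, hi, this]
  obtain ⟨Λ', hΛ'⟩ := exists_tendsto_sum_KExE W Iᶜ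
  have hΛ : Tendsto (fun u => ∑ i ∈ I, KExE W u i) (lowFilter Iᶜ) (𝓝 (2 * π * S.chi - Λ')) :=
    (hΛ'.const_sub _).congr fun u => by
      rw [← sum_KExE W u, ← Finset.sum_add_sum_compl I, add_sub_cancel_right]
  have hray : Tendsto (fun r : ℝ => ubar + r • d) atTop (lowFilter Iᶜ) :=
    tendsto_lowFilter fun i hi j hj => by
      rw [Finset.mem_compl] at hi hj
      rw [not_not] at hj
      have : Tendsto (fun r : ℝ => (ubar j - ubar i) + r) atTop atTop :=
        tendsto_atTop_add_const_left _ _ tendsto_id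
      refine this.congr fun r => ?_
      simp [hd, hi, hj]
      ring
  have hΛκ : κ ≤ 2 * π * S.chi - Λ' := by
    refine ge_of_tendsto (hΛ.comp hray) ((eventually_ge_atTop 1).mono fun r h => ?_)
    have := hr r h
    simpa only [hd, ite_mul, zero_mul, one_mul, Finset.sum_ite_mem, Finset.univ_inter,
      Function.comp_apply] using this
  obtain ⟨L, hL⟩ := mem_lowFilter.1
    (hΛ.eventually (lt_mem_nhds (show κ / 2 < 2 * π * S.chi - Λ' by linarith)))
  refine ⟨κ / 2, half_pos hκ, L, fun u hu => (hL fun j hj i hi => ?_).le⟩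
  rw [Finset.mem_compl] at hi hj
  exact hu i (not_not.1 hi) j hj

lemma exists_gap_mul_sum_KExE_le {α c : ℝ} (hα : α ≠ 0) (hαc : α * c ≤ 0) {ubar : Fin N → ℝ}
    (hbar : admissibleE W ubar) (hc : ∀ i, KExE W ubar i = c * exp (α * ubar i)) :
    ∃ δ > 0, ∃ L, ∀ I : Finset (Fin N), I.Nonempty → I ≠ Finset.univ → ∀ u : Fin N → ℝ,
      (∀ i ∈ I, ∀ j ∉ I, L ≤ α * u j - α * u i) → α * ∑ i ∈ I, KExE W u i ≤ -δ := by
  have h : ∀ I : Finset (Fin N), ∃ δ > 0, ∃ L, I.Nonempty → I ≠ Finset.univ → ∀ u : Fin N → ℝ,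
      (∀ i ∈ I, ∀ j ∉ I, L ≤ α * u j - α * u i) → α * ∑ i ∈ I, KExE W u i ≤ -δ := fun I => by
    by_cases hI : I.Nonempty ∧ I ≠ Finset.univ
    swap
    · exact ⟨1, one_pos, 0, fun h1 h2 => absurd ⟨h1, h2⟩ hI⟩
    rcases hα.lt_or_gt with hα | hα
    · have hc0 : 0 ≤ c := nonneg_of_mul_nonpos_right hαc hα
      obtain ⟨δ, hδ, L, hL⟩ := exists_gap_le_sum_KExE W hbar
        (fun i => hc i ▸ mul_nonneg hc0 (exp_pos _).le) hI.1 hI.2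
      refine ⟨-α * δ, mul_pos (neg_pos.2 hα) hδ, -α * L, fun _ _ u hu => ?_⟩
      have := hL u fun i hi j hj => by
        have := hu i hi j hj
        refine le_of_mul_le_mul_left ?_ (neg_pos.2 hα)
        linarith
      nlinarith
    · have hc0 : c ≤ 0 := nonpos_of_mul_nonpos_right hαc hα
      obtain ⟨δ, hδ, L, hL⟩ := exists_gap_sum_KExE_le W hbar
        (fun i => hc i ▸ mul_nonpos_of_nonpos_of_nonneg hc0 (exp_pos _).le) hI.1 hI.2
      refine ⟨α * δ, mul_pos hα hδ, α * L, fun _ _ u hu => ?_⟩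
      have := hL u fun i hi j hj => by
        have := hu i hi j hj
        refine le_of_mul_le_mul_left ?_ hα
        linarith
      nlinarith
  choose δ hδ L hL using h
  obtain ⟨Im, hIm⟩ := Finite.exists_min δ
  obtain ⟨IM, hIM⟩ := Finite.exists_max L
  exact ⟨δ Im, hδ Im, L IM, fun I h1 h2 u hu => (hL I h1 h2 u fun i hi j hj =>
    (hIM I).trans (hu i hi j hj)).trans (neg_le_neg (hIm I))⟩

end Degeneration

end TriSurface

lemma forall_le_of_forall_eventually_nhdsGT {ι : Type*} [Finite ι] {g : ι → ℝ → ℝ} {b : ι → ℝ}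
    (hg : ∀ i, ContinuousOn (g i) (Set.Ici 0)) (h0 : ∀ i, b i ≤ g i 0)
    (hstep : ∀ t, 0 ≤ t → (∀ τ ∈ Set.Icc 0 t, ∀ i, b i ≤ g i τ) →
      ∀ i, ∀ᶠ τ in 𝓝[>] t, b i ≤ g i τ) :
    ∀ t, 0 ≤ t → ∀ i, b i ≤ g i t := by
  intro T hT
  set C : Set ℝ := ⋂ i, Set.Icc 0 T ∩ g i ⁻¹' Set.Ici (b i) with hC
  have hCc : IsClosed C := isClosed_iInter fun i =>
    ((hg i).mono fun t ht => ht.1).preimage_isClosed_of_isClosed isClosed_Icc isClosed_Ici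
  set s : Set ℝ := {t | ∀ τ ∈ Set.Icc 0 t, ∀ i, b i ≤ g i τ} with hs
  have hsc : IsClosed (s ∩ Set.Icc 0 T) := by
    refine isClosed_of_closure_subset fun t ht => ?_
    have htT : t ∈ Set.Icc 0 T := closure_minimal Set.inter_subset_right isClosed_Icc ht
    refine ⟨fun τ hτ i => ?_, htT⟩
    have hmaps : Set.MapsTo (fun t' => min τ t') (s ∩ Set.Icc 0 T) C := fun t' ht' =>
      Set.mem_iInter.2 fun i => by
        have hmem : 0 ≤ min τ t' := le_min hτ.1 ht'.2.1
        exact ⟨⟨hmem, (min_le_right _ _).trans ht'.2.2⟩, ht'.1 _ ⟨hmem, min_le_right _ _⟩ i⟩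
    have := map_mem_closure (by fun_prop : Continuous fun t' => min τ t') ht hmaps
    rw [hCc.closure_eq, min_eq_left hτ.2] at this
    exact (Set.mem_iInter.1 this i).2
  have h0s : (0 : ℝ) ∈ s := fun τ hτ i => by
    rw [le_antisymm hτ.2 hτ.1]
    exact h0 i
  have hsub := hsc.Icc_subset_of_forall_mem_nhdsWithin h0s fun t ht => by
    have := eventually_all.2 (hstep t ht.2.1 ht.1)
    obtain ⟨v, hv, hvt⟩ := (mem_nhdsGT_iff_exists_Ioo_subset).1 this
    refine mem_nhdsGT_iff_exists_Ioo_subset.2 ⟨v, hv, fun t' ht' τ hτ => ?_⟩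
    rcases le_or_gt τ t with h | h
    · exact ht.1 τ ⟨hτ.1, h⟩
    · exact hvt ⟨h, hτ.2.trans_lt ht'.2⟩
  exact hsub ⟨hT, le_rfl⟩ T ⟨hT, le_rfl⟩

lemma eq_of_hasDerivWithinAt_mul_sub {y : ℝ → ℝ} {a A T : ℝ} (ha : a ≤ 0) (hT : 0 ≤ T)
    (h : ∀ t ∈ Set.Icc 0 T, HasDerivWithinAt y (a * (y t - A)) (Set.Ici 0) t) (h0 : y 0 = A) :
    y T = A := by
  have hd : ∀ t ∈ Set.Icc 0 T, HasDerivWithinAt (fun t => (y t - A) ^ 2)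
      (2 * a * (y t - A) ^ 2) (Set.Ici 0) t := fun t ht =>
    (((h t ht).sub_const A).pow 2).congr_deriv (by push_cast; ring)
  have hi : ∀ t ∈ interior (Set.Icc 0 T), HasDerivAt (fun t => (y t - A) ^ 2)
      (2 * a * (y t - A) ^ 2) t := fun t ht => by
    rw [interior_Icc] at ht
    exact (hd t (Set.Ioo_subset_Icc_self ht)).hasDerivAt (Ici_mem_nhds ht.1)
  have hanti : AntitoneOn (fun t => (y t - A) ^ 2) (Set.Icc 0 T) := by
    refine antitoneOn_of_deriv_nonpos (convex_Icc 0 T)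
      (fun t ht => (hd t ht).continuousWithinAt.mono fun s hs => hs.1)
      (fun t ht => (hi t ht).differentiableAt.differentiableWithinAt) fun t ht => ?_
    rw [(hi t ht).deriv]
    nlinarith [sq_nonneg (y t - A)]
  have := hanti ⟨le_rfl, hT⟩ ⟨hT, le_rfl⟩ hT
  simp only [h0, sub_self, ne_eq, OfNat.ofNat_ne_zero, not_false_eq_true, zero_pow] at this
  exact sub_eq_zero.1 (pow_eq_zero_iff two_ne_zero |>.1 (le_antisymm this (sq_nonneg _)))

lemma HasDerivWithinAt.eventually_nhdsGT_le {f : ℝ → ℝ} {f' t : ℝ} {s : Set ℝ}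
    (h : HasDerivWithinAt f f' s t) (hs : Set.Ioi t ⊆ s) (hf' : 0 < f') :
    ∀ᶠ τ in 𝓝[>] t, f t ≤ f τ := by
  have h1 := (hasDerivWithinAt_iff_tendsto_slope' (lt_irrefl t)).1 (h.mono hs)
  filter_upwards [h1.eventually (lt_mem_nhds hf'), self_mem_nhdsWithin] with τ hτ hτt
  rw [slope_def_field] at hτ
  exact (sub_pos.1 ((div_pos_iff_of_pos_right (sub_pos.2 hτt)).1 hτ)).le

namespace TriSurface

variable {N : ℕ} {S : TriSurface N}

section Existence

variable (W : Weights S)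

/-- The flow with the factors `e^{-α u_i}` truncated at height `M` has global solutions. -/
lemma exists_truncated_flow (α c : ℝ) {M : ℝ} (hM : 0 ≤ M) (u₀ : Fin N → ℝ) :
    ∃ u : ℝ → Fin N → ℝ, u 0 = u₀ ∧ ∀ t, 0 ≤ t → ∀ i, HasDerivWithinAt (fun s => u s i)
      (c - KExE W (u t) i * min (exp (-(α * u t i))) M) (Set.Ici 0) t := by
  obtain ⟨B, hB⟩ := exists_abs_KExE_le W
  have hK := continuous_KExE W
  have := nonempty_vertices S
  obtain ⟨i₀⟩ := this
  have hB0 : 0 ≤ B := (abs_nonneg _).trans (hB u₀ i₀)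
  obtain ⟨u, hu0, hu⟩ := exists_hasDerivWithinAt_Ici_of_continuous_of_bounded
    (f := fun (u : Fin N → ℝ) i => c - KExE W u i * min (exp (-(α * u i))) M)
    (K := |c| + B * M)
    (continuous_pi fun i => by
      have := (continuous_apply i).comp hK
      exact continuous_const.sub (this.mul (by fun_prop)))
    (fun u => (pi_norm_le_iff_of_nonneg (by positivity)).2 fun i => by
      refine (norm_sub_le _ _).trans (add_le_add le_rfl ?_)
      rw [norm_mul]
      refine mul_le_mul (hB u i) ?_ (norm_nonneg _) hB0
      rw [norm_eq_abs, abs_of_nonneg (le_min (exp_pos _).le hM)]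
      exact min_le_right _ _) u₀
  exact ⟨u, hu0, fun t ht i => hasDerivWithinAt_pi.1 (hu t ht) i⟩

theorem exists_isExtNormRicciSolE_of_ne_zero {α c : ℝ} (hα : α ≠ 0) (hαc : α * c ≤ 0)
    {ubar : Fin N → ℝ} (hbar : admissibleE W ubar)
    (hc : ∀ i, KExE W ubar i = c * exp (α * ubar i)) {u₀ : Fin N → ℝ}
    (hcA : 2 * π * S.chi = c * ∑ i, exp (α * u₀ i)) :
    ∃ u : ℝ → Fin N → ℝ, u 0 = u₀ ∧ IsExtNormRicciSolE W α u := by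
  have hN := nonempty_vertices S
  obtain ⟨δ, hδ, L, hL⟩ := exists_gap_mul_sum_KExE_le W hα hαc hbar hc
  obtain ⟨im, him⟩ := Finite.exists_min fun i => exp (α * u₀ i)
  obtain ⟨m, hm0, hm⟩ : ∃ m > 0, m < exp (α * u₀ im) ∧ -(α * c) * m < δ := by
    have h1 : Tendsto (fun m : ℝ => -(α * c) * m) (𝓝[>] 0) (𝓝 0) := by
      have : Tendsto (fun m : ℝ => -(α * c) * m) (𝓝 0) (𝓝 (-(α * c) * 0)) :=
        Continuous.tendsto (by fun_prop) 0
      rw [mul_zero] at this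
      exact this.mono_left nhdsWithin_le_nhds
    have h2 : ∀ᶠ m : ℝ in 𝓝[>] 0, 0 < m := self_mem_nhdsWithin
    have h3 : ∀ᶠ m : ℝ in 𝓝[>] 0, m < exp (α * u₀ im) :=
      nhdsWithin_le_nhds (gt_mem_nhds (exp_pos _))
    obtain ⟨m, h2, h3, h4⟩ := (h2.and (h3.and (h1.eventually (gt_mem_nhds hδ)))).exists
    exact ⟨m, h2, h3, h4⟩
  set A := ∑ i, exp (α * u₀ i) with hA
  set ρ : ℝ := (1 + exp L)⁻¹ with hρ
  have hρ0 : 0 < ρ := by positivity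
  have hρ1 : ρ ≤ 1 := inv_le_one_of_one_le₀ (by linarith [exp_pos L])
  set b : ℕ → ℝ := fun k => m * ρ ^ (N - k) with hb
  have hb0 : ∀ k, 0 < b k := fun k => by positivity
  have hbm : ∀ k, b k ≤ m := fun k => mul_le_of_le_one_right hm0.le (pow_le_one₀ hρ0.le hρ1)
  have hbstep : ∀ k, k < N → b (k + 1) = b k + b k * exp L := fun k hk => by
    have : N - k = (N - (k + 1)) + 1 := by omega
    simp only [hb, this, pow_succ, hρ]
    field_simp
  obtain ⟨u, hu0, hu⟩ := exists_truncated_flow W α c (M := (b 1)⁻¹) (inv_pos.2 (hb0 1)).le u₀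
  set s : Finset (Fin N) → ℝ → ℝ := fun I t => ∑ i ∈ I, exp (α * u t i) with hs
  have hcont : ∀ I, ContinuousOn (s I) (Set.Ici 0) := fun I t ht =>
    (HasDerivWithinAt.fun_sum fun i (_ : i ∈ I) =>
      ((hu t ht i).const_mul α).exp).continuousWithinAt
  have hunclip : ∀ t, (∀ I : {I : Finset (Fin N) // I.Nonempty}, b I.1.card ≤ s I.1 t) →
      ∀ i, min (exp (-(α * u t i))) (b 1)⁻¹ = exp (-(α * u t i)) := fun t h i => by
    have := h ⟨{i}, Finset.singleton_nonempty i⟩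
    simp only [Finset.card_singleton, hs, Finset.sum_singleton] at this
    rw [min_eq_left]
    rw [exp_neg]
    exact inv_anti₀ (hb0 1) this
  have hderiv : ∀ t, 0 ≤ t →
      (∀ I : {I : Finset (Fin N) // I.Nonempty}, b I.1.card ≤ s I.1 t) →
      ∀ I, HasDerivWithinAt (s I) (α * c * s I t - α * ∑ i ∈ I, KExE W (u t) i)
        (Set.Ici 0) t := fun t ht h I => by
    refine (HasDerivWithinAt.fun_sum fun i (_ : i ∈ I) =>
      ((hu t ht i).const_mul α).exp).congr_deriv ?_
    simp only [hs, Finset.mul_sum, ← Finset.sum_sub_distrib]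
    refine Finset.sum_congr rfl fun i _ => ?_
    rw [hunclip t h i, exp_neg]
    have := exp_ne_zero (α * u t i)
    field_simp
  have htotal : ∀ T, 0 ≤ T → (∀ t ∈ Set.Icc 0 T,
      ∀ I : {I : Finset (Fin N) // I.Nonempty}, b I.1.card ≤ s I.1 t) →
      s Finset.univ T = A := fun T hT h => by
    refine eq_of_hasDerivWithinAt_mul_sub hαc hT (fun t ht => ?_) (by simp only [hs, hu0, hA])
    refine (hderiv t ht.1 (h t ht) Finset.univ).congr_deriv ?_
    rw [sum_KExE, hcA]
    ring
  have hinv : ∀ t, 0 ≤ t →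
      ∀ I : {I : Finset (Fin N) // I.Nonempty}, b I.1.card ≤ s I.1 t := by
    refine forall_le_of_forall_eventually_nhdsGT (fun I => hcont I.1) (fun I => ?_)
      fun t ht hP I => ?_
    · obtain ⟨I, i, hi⟩ := I
      have h1 := Finset.single_le_sum (f := fun i => exp (α * u₀ i))
        (fun i _ => (exp_pos _).le) hi
      simp only [hs, hu0]
      linarith [hbm I.card, him i, hm.1]
    obtain ⟨I, hI⟩ := I
    have hPt := hP t ⟨ht, le_rfl⟩
    rcases (hPt ⟨I, hI⟩).lt_or_eq with hlt | heq
    · have := ((hcont I) t ht).mono (Set.Ioi_subset_Ici ht)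
      exact (this.eventually (lt_mem_nhds hlt)).mono fun τ h => h.le
    simp only at heq ⊢
    have hIu : I ≠ Finset.univ := by
      rintro rfl
      rw [htotal t ht hP] at heq
      have h1 := Finset.single_le_sum (f := fun i => exp (α * u₀ i))
        (fun i _ => (exp_pos _).le) (Finset.mem_univ im)
      linarith [hbm (Finset.univ : Finset (Fin N)).card, hm.1]
    have hcard : I.card < N := by
      simpa using Finset.card_lt_univ_of_notMem
        (not_forall.1 (mt Finset.eq_univ_iff_forall.2 hIu)).choose_spec
    have hgap := hL I hI hIu (u t) fun i hi j hj => by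
      have h1 := hPt ⟨insert j I, Finset.insert_nonempty j I⟩
      simp only [Finset.card_insert_of_notMem hj, hs, Finset.sum_insert hj] at h1
      rw [hbstep _ hcard] at h1
      have h2 := Finset.single_le_sum (f := fun i => exp (α * u t i))
        (fun i _ => (exp_pos _).le) hi
      simp only [hs] at heq
      have h3 : exp (α * u t i) * exp L ≤ exp (α * u t j) := by
        have := mul_le_mul_of_nonneg_right (h2.trans_eq heq.symm) (exp_pos L).le
        linarith
      rw [← exp_add] at h3
      linarith [exp_le_exp.1 h3]
    rw [heq]
    refine (hderiv t ht hPt I).eventually_nhdsGT_le (Set.Ioi_subset_Ici ht) ?_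
    have h1 : α * c * m ≤ α * c * s I t :=
      mul_le_mul_of_nonpos_left (heq ▸ hbm _) hαc
    linarith [hm.2]
  refine ⟨u, hu0, fun t ht i => (hu t ht i).congr_deriv ?_⟩
  have h1 := htotal t ht fun τ hτ => hinv τ hτ.1
  simp only [hs] at h1
  have hA0 : 0 < A := Finset.sum_pos (fun j _ => exp_pos _) Finset.univ_nonempty
  rw [hunclip t (hinv t ht) i, h1, RExE, hcA, mul_div_cancel_right₀ _ hA0.ne']

theorem exists_isExtNormRicciSolE_zero (u₀ : Fin N → ℝ) :
    ∃ u : ℝ → Fin N → ℝ, u 0 = u₀ ∧ IsExtNormRicciSolE W 0 u := by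
  obtain ⟨u, hu0, hu⟩ := exists_truncated_flow W 0 (2 * π * S.chi / N) zero_le_one u₀
  refine ⟨u, hu0, fun t ht i => (hu t ht i).congr_deriv ?_⟩
  simp [RExE]

end Existence

end TriSurface

end FlowAnalysis

/-- global convergence of the extended normalized combinatorial
`α`-Ricci flow, Euclidean background.  Let `αχ ≤ 0` and let `ū ∈ U^E` have constant
combinatorial `α`-curvature.  Then for every initial value `u(0) ∈ ℝᴺ` with
`Σ e^{α u_i(0)} = Σ e^{α ū_i}` (when `α ≠ 0`), resp. `Σ u_i(0) = Σ ū_i` (when `α = 0`),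
the extended normalized combinatorial `α`-Ricci flow admits a global solution starting at
`u(0)`, and every such global solution converges exponentially fast to `ū`. -/
theorem extended_normalized_ricci_flow_global_convergence {N : ℕ} (S : TriSurface N)
    (W : TriSurface.Weights S) (α : ℝ) (hαχ : α * (S.chi : ℝ) ≤ 0)
    (ubar : Fin N → ℝ) (hbar : admissibleE W ubar)
    (hconst : ∃ c : ℝ, ∀ i, RE W α ubar i = c)
    (u0 : Fin N → ℝ)
    (h1 : α ≠ 0 → ∑ i, Real.exp (α * u0 i) = ∑ i, Real.exp (α * ubar i))
    (h2 : α = 0 → ∑ i, u0 i = ∑ i, ubar i) :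
    (∃ u : ℝ → Fin N → ℝ, u 0 = u0 ∧ IsExtNormRicciSolE W α u ∧ ExpConvergesTo u ubar) ∧
    (∀ u : ℝ → Fin N → ℝ, u 0 = u0 → IsExtNormRicciSolE W α u → ExpConvergesTo u ubar) := by
  have hconv : ∀ u : ℝ → Fin N → ℝ, u 0 = u0 → IsExtNormRicciSolE W α u →
      ExpConvergesTo u ubar := fun u hu0 hu =>
    hu.expConvergesTo hαχ hbar hconst (by rwa [hu0]) (by rwa [hu0])
  refine ⟨?_, hconv⟩
  suffices h : ∃ u : ℝ → Fin N → ℝ, u 0 = u0 ∧ IsExtNormRicciSolE W α u from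
    h.imp fun u hu => ⟨hu.1, hu.2, hconv u hu.1 hu.2⟩
  by_cases hα : α = 0
  · subst hα
    exact exists_isExtNormRicciSolE_zero W u0
  obtain ⟨c, hc, hcA, hαc⟩ := exists_KExE_eq_const_mul_exp W hαχ hconst
  rw [← h1 hα] at hcA
  exact exists_isExtNormRicciSolE_of_ne_zero W hα hαc hbar hc hcA
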